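/- arXiv:2503.05523 — 10 statements merged into one kernel-verified Lean document; each statement's English description precedes it below -/
import Mathlib

section
/- Let a₁, a₂, b₁, b₂ ∈ ℝ³ be unit vectors, let α ∈ (0, π) be the angle between a₁ and a₂ (cos α = a₁·a₂) and β ∈ (0, π) the angle between b₁ and b₂ (cos β = b₁·b₂), and set A_i := a_i·σ, B_j := b_j·σ for i, j ∈ {1,2}. Then for real numbers γ₁₁, γ₂₁, γ₁₂, γ₂₂, there exists a density matrix ρ on ℂ²⊗ℂ² with Tr[ρ (A_i ⊗ B_j)] = γ_{ij} for all i, j ∈ {1,2} if and only if √(γᵀ F_{α,β} γ) + √(γᵀ F_{α,−β} γ) ≤ 2, where γ := (γ₁₁, γ₂₁, γ₁₂, γ₂₂)ᵀ. -/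
open Matrix Kronecker Real ComplexOrder

noncomputable section

def σ1 : Matrix (Fin 2) (Fin 2) ℂ := !![0, 1; 1, 0]
def σ2 : Matrix (Fin 2) (Fin 2) ℂ := !![0, -Complex.I; Complex.I, 0]
def σ3 : Matrix (Fin 2) (Fin 2) ℂ := !![1, 0; 0, -1]

/-- For `a ∈ ℝ³`, `a·σ := a₁σ₁ + a₂σ₂ + a₃σ₃`. -/
def dotSigma (a : Fin 3 → ℝ) : Matrix (Fin 2) (Fin 2) ℂ :=
  (a 0 : ℂ) • σ1 + (a 1 : ℂ) • σ2 + (a 2 : ℂ) • σ3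

/-- Euclidean dot product on `ℝ³`. -/
def dot3 (a b : Fin 3 → ℝ) : ℝ := a 0 * b 0 + a 1 * b 1 + a 2 * b 2

/-- A density matrix on `ℂ² ⊗ ℂ²`: positive semidefinite with trace 1. -/
def IsDensityMatrix (ρ : Matrix (Fin 2 × Fin 2) (Fin 2 × Fin 2) ℂ) : Prop :=
  ρ.PosSemidef ∧ ρ.trace = 1

/-- The matrix `F_{α,β}`. -/
def Fmat (α β : ℝ) : Matrix (Fin 4) (Fin 4) ℝ :=
  (1 / (Real.sin α ^ 2 * Real.sin β ^ 2)) •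
    !![1, -Real.cos α, -Real.cos β, Real.cos (α + β);
       -Real.cos α, 1, Real.cos (α - β), -Real.cos β;
       -Real.cos β, Real.cos (α - β), 1, -Real.cos α;
       Real.cos (α + β), -Real.cos β, -Real.cos α, 1]

/-- The quadratic form `γᵀ F_{α,β} γ`. -/
def quadForm (α β : ℝ) (γ : Fin 4 → ℝ) : ℝ := γ ⬝ᵥ (Fmat α β *ᵥ γ)

/-- Clifford pair of traceless Hermitian 2×2 matrices. -/
structure CliffPair (E1 E2 : Matrix (Fin 2) (Fin 2) ℂ) : Prop where
  h1 : E1ᴴ = E1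
  h2 : E2ᴴ = E2
  s1 : E1 * E1 = 1
  s2 : E2 * E2 = 1
  ac : E2 * E1 = -(E1 * E2)
  t1 : E1.trace = 0
  t2 : E2.trace = 0

theorem CliffPair.t12 {E1 E2 : Matrix (Fin 2) (Fin 2) ℂ} (h : CliffPair E1 E2) :
    (E1 * E2).trace = 0 := by
  have h1 := Matrix.trace_mul_comm E1 E2
  rw [h.ac, Matrix.trace_neg] at h1
  linear_combination (1 / 2 : ℂ) * h1

theorem CliffPair.t121 {E1 E2 : Matrix (Fin 2) (Fin 2) ℂ} (h : CliffPair E1 E2) :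
    (E1 * E2 * E1).trace = 0 := by
  rw [Matrix.mul_assoc, h.ac, Matrix.mul_neg, ← Matrix.mul_assoc, h.s1, Matrix.one_mul,
    Matrix.trace_neg, h.t2, neg_zero]

theorem CliffPair.t122 {E1 E2 : Matrix (Fin 2) (Fin 2) ℂ} (h : CliffPair E1 E2) :
    (E1 * E2 * E2).trace = 0 := by
  rw [Matrix.mul_assoc, h.s2, Matrix.mul_one, h.t1]

theorem posSemidef_aux {n : Type*} [Fintype n] [DecidableEq n] (H Q : Matrix n n ℂ) (p m : ℝ)
    (hH : Hᴴ = H) (hQ : Qᴴ = Q) (hQQ : Q * Q = Q) (hc : Q * H = H * Q)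
    (hm : H * H * Q = (m : ℂ) • Q) (hp : 0 ≤ p) (hmp : m ≤ p ^ 2) :
    ((p : ℂ) • Q + H * Q).PosSemidef := by
  have hQpsd : Q.PosSemidef := by
    have := Matrix.posSemidef_conjTranspose_mul_self Q
    rwa [hQ, hQQ] at this
  have hHQ : (H * Q)ᴴ * (H * Q) = (m : ℂ) • Q := by
    rw [Matrix.conjTranspose_mul, hH, hQ, ← hm, hc, Matrix.mul_assoc H Q, ← Matrix.mul_assoc Q H,
      hc, Matrix.mul_assoc H Q Q, hQQ, Matrix.mul_assoc]
  rcases hp.eq_or_lt with rfl | hp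
  · have hz : H * Q = 0 := by
      have h2 : ((H * Q)ᴴ * (H * Q)).PosSemidef := Matrix.posSemidef_conjTranspose_mul_self _
      have h3 : ((-m : ℝ) : ℂ) • Q = -((H * Q)ᴴ * (H * Q)) := by
        rw [hHQ]; simp
      have h4 : (((-m : ℝ) : ℂ) • Q).PosSemidef :=
        hQpsd.smul (by rw [Complex.zero_le_real]; simpa using hmp)
      rw [h3] at h4
      have h5 := h2.trace_nonneg
      have h6 := h4.trace_nonneg
      rw [Matrix.trace_neg] at h6
      have h7 : ((H * Q)ᴴ * (H * Q)).trace = 0 := le_antisymm (by simpa using h6) h5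
      exact Matrix.trace_conjTranspose_mul_self_eq_zero_iff.mp h7
    rw [hz]; simpa using Matrix.PosSemidef.zero
  · have hpc : (p : ℂ) ≠ 0 := by exact_mod_cast hp.ne'
    have key : (p : ℂ) • Q + H * Q = ((1 / (2 * p) : ℝ) : ℂ) •
        (((p : ℂ) • Q + H * Q)ᴴ * ((p : ℂ) • Q + H * Q) + ((p ^ 2 - m : ℝ) : ℂ) • Q) := by
      have e1 : ((p : ℂ) • Q + H * Q)ᴴ = (p : ℂ) • Q + (H * Q)ᴴ := by
        rw [Matrix.conjTranspose_add, Matrix.conjTranspose_smul, hQ]; simp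
      have e2 : (H * Q)ᴴ * Q = H * Q := by
        rw [Matrix.conjTranspose_mul, hH, hQ, hc, Matrix.mul_assoc, hQQ]
      have e3 : Q * (H * Q) = H * Q := by
        rw [← Matrix.mul_assoc, hc, Matrix.mul_assoc, hQQ]
      rw [e1, Matrix.add_mul, Matrix.mul_add, Matrix.mul_add, hHQ]
      simp only [Matrix.smul_mul, Matrix.mul_smul, hQQ, e2, e3]
      push_cast
      match_scalars <;> field_simp <;> ring
    rw [key]
    refine Matrix.PosSemidef.smul (Matrix.PosSemidef.add
      (Matrix.posSemidef_conjTranspose_mul_self _) (hQpsd.smul ?_)) ?_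
    · rw [Complex.zero_le_real]; linarith
    · rw [Complex.zero_le_real]; positivity

def comb (E1 E2 F1 F2 : Matrix (Fin 2) (Fin 2) ℂ) (T11 T12 T21 T22 : ℝ) :
    Matrix (Fin 2 × Fin 2) (Fin 2 × Fin 2) ℂ :=
  (T11 : ℂ) • (E1 ⊗ₖ F1) + (T12 : ℂ) • (E1 ⊗ₖ F2) + (T21 : ℂ) • (E2 ⊗ₖ F1)
    + (T22 : ℂ) • (E2 ⊗ₖ F2)

theorem comb_herm {E1 E2 F1 F2 : Matrix (Fin 2) (Fin 2) ℂ} (hE : CliffPair E1 E2)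
    (hF : CliffPair F1 F2) (T11 T12 T21 T22 : ℝ) :
    (comb E1 E2 F1 F2 T11 T12 T21 T22)ᴴ = comb E1 E2 F1 F2 T11 T12 T21 T22 := by
  simp [comb, Matrix.conjTranspose_kronecker, hE.h1, hE.h2, hF.h1, hF.h2]

theorem neg_kron (A B : Matrix (Fin 2) (Fin 2) ℂ) : (-A) ⊗ₖ B = -(A ⊗ₖ B) := by
  ext i j; simp [Matrix.kroneckerMap_apply]

theorem kron_neg (A B : Matrix (Fin 2) (Fin 2) ℂ) : A ⊗ₖ (-B) = -(A ⊗ₖ B) := by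
  ext i j; simp [Matrix.kroneckerMap_apply]

theorem comb_sq {E1 E2 F1 F2 : Matrix (Fin 2) (Fin 2) ℂ} (hE : CliffPair E1 E2)
    (hF : CliffPair F1 F2) (T11 T12 T21 T22 : ℝ) :
    comb E1 E2 F1 F2 T11 T12 T21 T22 * comb E1 E2 F1 F2 T11 T12 T21 T22 =
    ((T11 ^ 2 + T12 ^ 2 + T21 ^ 2 + T22 ^ 2 : ℝ) : ℂ) • (1 : Matrix _ _ ℂ)
      + ((2 * (T11 * T22 - T12 * T21) : ℝ) : ℂ) • ((E1 * E2) ⊗ₖ (F1 * F2)) := by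
  simp only [comb, Matrix.add_mul, Matrix.mul_add, Matrix.smul_mul, Matrix.mul_smul,
    ← Matrix.mul_kronecker_mul, hE.s1, hE.s2, hF.s1, hF.s2, hE.ac, hF.ac, neg_kron, kron_neg,
    Matrix.one_kronecker_one]
  push_cast
  module

theorem P_sq {E1 E2 F1 F2 : Matrix (Fin 2) (Fin 2) ℂ} (hE : CliffPair E1 E2)
    (hF : CliffPair F1 F2) :
    ((E1 * E2) ⊗ₖ (F1 * F2)) * ((E1 * E2) ⊗ₖ (F1 * F2)) = 1 := by
  have h : ∀ {A B : Matrix (Fin 2) (Fin 2) ℂ}, CliffPair A B → (A * B) * (A * B) = -1 := by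
    intro A B h
    rw [Matrix.mul_assoc, ← Matrix.mul_assoc B, h.ac, Matrix.neg_mul, Matrix.mul_neg,
      Matrix.mul_assoc A B B, h.s2, Matrix.mul_one, h.s1]
  rw [← Matrix.mul_kronecker_mul, h hE, h hF, neg_kron, kron_neg, neg_neg,
    Matrix.one_kronecker_one]

theorem P_herm {E1 E2 F1 F2 : Matrix (Fin 2) (Fin 2) ℂ} (hE : CliffPair E1 E2)
    (hF : CliffPair F1 F2) :
    ((E1 * E2) ⊗ₖ (F1 * F2))ᴴ = ((E1 * E2) ⊗ₖ (F1 * F2)) := by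
  rw [Matrix.conjTranspose_kronecker, Matrix.conjTranspose_mul, Matrix.conjTranspose_mul,
    hE.h1, hE.h2, hF.h1, hF.h2, hE.ac, hF.ac, neg_kron, kron_neg, neg_neg]

theorem P_comm {E1 E2 F1 F2 : Matrix (Fin 2) (Fin 2) ℂ} (hE : CliffPair E1 E2)
    (hF : CliffPair F1 F2) (T11 T12 T21 T22 : ℝ) :
    ((E1 * E2) ⊗ₖ (F1 * F2)) * comb E1 E2 F1 F2 T11 T12 T21 T22 =
      comb E1 E2 F1 F2 T11 T12 T21 T22 * ((E1 * E2) ⊗ₖ (F1 * F2)) := by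
  have h1 : ∀ {A B : Matrix (Fin 2) (Fin 2) ℂ}, CliffPair A B → (A * B) * A = -(A * (A * B)) := by
    intro A B h
    rw [Matrix.mul_assoc, h.ac, Matrix.mul_neg]
  have h2 : ∀ {A B : Matrix (Fin 2) (Fin 2) ℂ}, CliffPair A B → (A * B) * B = -(B * (A * B)) := by
    intro A B h
    rw [← Matrix.mul_assoc B, h.ac, Matrix.neg_mul, neg_neg]
  simp only [comb, Matrix.add_mul, Matrix.mul_add, Matrix.smul_mul, Matrix.mul_smul,
    ← Matrix.mul_kronecker_mul, h1 hE, h1 hF, h2 hE, h2 hF, neg_kron, kron_neg, neg_neg]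

theorem exists_rho {E1 E2 F1 F2 : Matrix (Fin 2) (Fin 2) ℂ} (hE : CliffPair E1 E2)
    (hF : CliffPair F1 F2) (T11 T12 T21 T22 : ℝ)
    (hS : T11 ^ 2 + T12 ^ 2 + T21 ^ 2 + T22 ^ 2 ≤ 2)
    (hD : T11 ^ 2 + T12 ^ 2 + T21 ^ 2 + T22 ^ 2 ≤ 1 + (T11 * T22 - T12 * T21) ^ 2) :
    ∃ ρ : Matrix (Fin 2 × Fin 2) (Fin 2 × Fin 2) ℂ, IsDensityMatrix ρ ∧
        (ρ * (E1 ⊗ₖ F1)).trace = (T11 : ℂ) ∧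
        (ρ * (E1 ⊗ₖ F2)).trace = (T12 : ℂ) ∧
        (ρ * (E2 ⊗ₖ F1)).trace = (T21 : ℂ) ∧
        (ρ * (E2 ⊗ₖ F2)).trace = (T22 : ℂ) := by
  set D := T11 * T22 - T12 * T21 with hDdef
  set S := T11 ^ 2 + T12 ^ 2 + T21 ^ 2 + T22 ^ 2 with hSdef
  set M := comb E1 E2 F1 F2 T11 T12 T21 T22 with hM
  set P := (E1 * E2) ⊗ₖ (F1 * F2) with hP
  have hPP : P * P = 1 := P_sq hE hF
  have hPh : Pᴴ = P := P_herm hE hF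
  have hPc : P * M = M * P := P_comm hE hF ..
  have hMM : M * M = (S : ℂ) • (1 : Matrix _ _ ℂ) + ((2 * D : ℝ) : ℂ) • P := comb_sq hE hF ..
  have hMh : Mᴴ = M := comb_herm hE hF ..
  have hD1 : 2 * D ≤ S := by nlinarith [sq_nonneg (T11 - T22), sq_nonneg (T12 + T21)]
  have hD2 : -(2 * D) ≤ S := by nlinarith [sq_nonneg (T11 + T22), sq_nonneg (T12 - T21)]
  have half : ∀ ε : ℝ, ε ^ 2 = 1 → 0 ≤ 1 + ε * D →
      (((1 + ε * D : ℝ) : ℂ) • ((1 / 2 : ℂ) • (1 + (ε : ℂ) • P))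
        + M * ((1 / 2 : ℂ) • (1 + (ε : ℂ) • P))).PosSemidef := by
    intro ε hε hpos
    have hεc : (ε : ℂ) * ε = 1 := by rw [← sq]; exact_mod_cast hε
    refine posSemidef_aux M _ (1 + ε * D) (S + 2 * ε * D) hMh ?_ ?_ ?_ ?_ hpos ?_
    · simp [hPh]
    · simp only [Matrix.smul_mul, Matrix.mul_smul, Matrix.add_mul, Matrix.mul_add, Matrix.one_mul,
        Matrix.mul_one, hPP]
      match_scalars
      · linear_combination (1 / 4 : ℂ) * hεc
      · ring
    · simp only [Matrix.smul_mul, Matrix.mul_smul, Matrix.add_mul, Matrix.mul_add, Matrix.one_mul,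
        Matrix.mul_one, hPc]
    · rw [hMM]
      simp only [Matrix.smul_mul, Matrix.mul_smul, Matrix.add_mul, Matrix.mul_add, Matrix.one_mul,
        Matrix.mul_one, hPP]
      push_cast
      match_scalars
      · ring
      · linear_combination (-(D : ℂ)) * hεc
    · nlinarith
  have hR : ((1 : Matrix _ _ ℂ) + M + (D : ℂ) • P).PosSemidef := by
    have := (half 1 (by norm_num) (by linarith)).add (half (-1) (by norm_num) (by linarith))
    convert this using 1
    simp only [Matrix.mul_smul, Matrix.mul_add, Matrix.mul_one]
    push_cast
    module
  have tPt : P.trace = 0 := by rw [hP, Matrix.trace_kronecker, hE.t12, zero_mul]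
  have tM : M.trace = 0 := by
    simp [hM, comb, Matrix.trace_kronecker, hE.t1, hE.t2]
  refine ⟨(1 / 4 : ℂ) • ((1 : Matrix _ _ ℂ) + M + (D : ℂ) • P), ⟨hR.smul ?_, ?_⟩, ?_, ?_, ?_, ?_⟩
  · have : (1 / 4 : ℂ) = ((1 / 4 : ℝ) : ℂ) := by push_cast; rfl
    rw [this, Complex.zero_le_real]; norm_num
  · simp [Matrix.trace_add, Matrix.trace_smul, tPt, tM]
  all_goals
    simp only [hM, hP, comb, Matrix.smul_mul, Matrix.add_mul, Matrix.one_mul,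
      ← Matrix.mul_kronecker_mul, Matrix.trace_add, Matrix.trace_smul, Matrix.trace_kronecker,
      hE.t121, hE.t122, hE.t12, hF.t12, hE.s1, hE.s2, hF.s1, hF.s2, hE.t1, hE.t2, hE.ac, hF.ac,
      Matrix.trace_neg, Matrix.trace_one]
    simp
    ring

theorem necessity {E1 E2 F1 F2 : Matrix (Fin 2) (Fin 2) ℂ} (hE : CliffPair E1 E2)
    (hF : CliffPair F1 F2) (T11 T12 T21 T22 : ℝ)
    (ρ : Matrix (Fin 2 × Fin 2) (Fin 2 × Fin 2) ℂ) (hρ : IsDensityMatrix ρ)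
    (h11 : (ρ * (E1 ⊗ₖ F1)).trace = (T11 : ℂ))
    (h12 : (ρ * (E1 ⊗ₖ F2)).trace = (T12 : ℂ))
    (h21 : (ρ * (E2 ⊗ₖ F1)).trace = (T21 : ℂ))
    (h22 : (ρ * (E2 ⊗ₖ F2)).trace = (T22 : ℂ)) :
    T11 ^ 2 + T12 ^ 2 + T21 ^ 2 + T22 ^ 2 ≤ 2 ∧
    T11 ^ 2 + T12 ^ 2 + T21 ^ 2 + T22 ^ 2 ≤ 1 + (T11 * T22 - T12 * T21) ^ 2 := by
  have basic : ∀ p x1 x2 y1 y2 : ℝ,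
      0 ≤ p ^ 2 + 2 * p * (T11 * (x1 * y1) + T12 * (x1 * y2) + T21 * (x2 * y1) + T22 * (x2 * y2))
        + (x1 ^ 2 + x2 ^ 2) * (y1 ^ 2 + y2 ^ 2) := by
    intro p x1 x2 y1 y2
    set M := comb E1 E2 F1 F2 (x1 * y1) (x1 * y2) (x2 * y1) (x2 * y2) with hM
    have hMh : Mᴴ = M := comb_herm hE hF ..
    have hMM : M * M = (((x1 * y1) ^ 2 + (x1 * y2) ^ 2 + (x2 * y1) ^ 2 + (x2 * y2) ^ 2 : ℝ) : ℂ) •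
        (1 : Matrix _ _ ℂ) := by
      rw [hM, comb_sq hE hF]
      have : 2 * (x1 * y1 * (x2 * y2) - x1 * y2 * (x2 * y1)) = 0 := by ring
      rw [this]; simp
    have hpsd := (hρ.1.mul_mul_conjTranspose_same ((p : ℂ) • (1 : Matrix _ _ ℂ) + M)).trace_nonneg
    have hNh : ((p : ℂ) • (1 : Matrix _ _ ℂ) + M)ᴴ = (p : ℂ) • (1 : Matrix _ _ ℂ) + M := by
      simp [hMh]
    rw [hNh, Matrix.trace_mul_comm, ← Matrix.mul_assoc, Matrix.trace_mul_comm] at hpsd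
    have hNN : ((p : ℂ) • (1 : Matrix (Fin 2 × Fin 2) (Fin 2 × Fin 2) ℂ) + M) *
        ((p : ℂ) • (1 : Matrix _ _ ℂ) + M)
        = ((p ^ 2 + (x1 ^ 2 + x2 ^ 2) * (y1 ^ 2 + y2 ^ 2) : ℝ) : ℂ) • (1 : Matrix _ _ ℂ)
          + ((2 * p : ℝ) : ℂ) • M := by
      simp only [Matrix.smul_mul, Matrix.mul_smul, Matrix.add_mul, Matrix.mul_add, Matrix.one_mul,
        Matrix.mul_one, hMM]
      push_cast
      module
    have hM1 : (ρ * M).trace = ((T11 * (x1 * y1) + T12 * (x1 * y2) + T21 * (x2 * y1)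
        + T22 * (x2 * y2) : ℝ) : ℂ) := by
      simp only [hM, comb, Matrix.mul_add, Matrix.mul_smul, Matrix.trace_add, Matrix.trace_smul,
        h11, h12, h21, h22]
      push_cast
      simp only [smul_eq_mul]
      ring
    rw [hNN, Matrix.mul_add, Matrix.mul_smul, Matrix.mul_smul, Matrix.mul_one, Matrix.trace_add,
      Matrix.trace_smul, Matrix.trace_smul, hρ.2, hM1, smul_eq_mul, smul_eq_mul, mul_one,
      ← Complex.ofReal_mul, ← Complex.ofReal_add, Complex.zero_le_real] at hpsd
    linarith
  have contr : ∀ y1 y2 : ℝ, (T11 * y1 + T12 * y2) ^ 2 + (T21 * y1 + T22 * y2) ^ 2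
      ≤ y1 ^ 2 + y2 ^ 2 := by
    intro y1 y2
    have h := basic (-((T11 * y1 + T12 * y2) ^ 2 + (T21 * y1 + T22 * y2) ^ 2))
      (T11 * y1 + T12 * y2) (T21 * y1 + T22 * y2) y1 y2
    set u := T11 * y1 + T12 * y2 with hu
    set v := T21 * y1 + T22 * y2 with hv
    by_contra hlt
    push Not at hlt
    have hN : 0 < u ^ 2 + v ^ 2 := lt_of_le_of_lt (by positivity) hlt
    have h' : 0 ≤ (u ^ 2 + v ^ 2) * ((y1 ^ 2 + y2 ^ 2) - (u ^ 2 + v ^ 2)) := by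
      have : T11 * (u * y1) + T12 * (u * y2) + T21 * (v * y1) + T22 * (v * y2) = u ^ 2 + v ^ 2 := by
        rw [hu, hv]; ring
      rw [this] at h
      linarith
    nlinarith
  have hA := contr 1 0
  have hC := contr 0 1
  refine ⟨by nlinarith, ?_⟩
  have hq : discrim (1 - T11 ^ 2 - T21 ^ 2) (-(2 * (T11 * T12 + T21 * T22)))
      (1 - T12 ^ 2 - T22 ^ 2) ≤ 0 := by
    apply discrim_le_zero
    intro x
    have := contr x 1
    nlinarith
  unfold discrim at hq
  nlinarith

theorem sqrt_cond (T11 T12 T21 T22 : ℝ) :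
    √((T11 - T22) ^ 2 + (T12 + T21) ^ 2) + √((T11 + T22) ^ 2 + (T12 - T21) ^ 2) ≤ 2 ↔
    (T11 ^ 2 + T12 ^ 2 + T21 ^ 2 + T22 ^ 2 ≤ 2 ∧
    T11 ^ 2 + T12 ^ 2 + T21 ^ 2 + T22 ^ 2 ≤ 1 + (T11 * T22 - T12 * T21) ^ 2) := by
  set S := T11 ^ 2 + T12 ^ 2 + T21 ^ 2 + T22 ^ 2 with hS
  set D := T11 * T22 - T12 * T21 with hD
  have e1 : (T11 - T22) ^ 2 + (T12 + T21) ^ 2 = S - 2 * D := by rw [hS, hD]; ring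
  have e2 : (T11 + T22) ^ 2 + (T12 - T21) ^ 2 = S + 2 * D := by rw [hS, hD]; ring
  have n1 : 0 ≤ S - 2 * D := by rw [← e1]; positivity
  have n2 : 0 ≤ S + 2 * D := by rw [← e2]; positivity
  rw [e1, e2]
  have q1 := Real.sq_sqrt n1
  have q2 := Real.sq_sqrt n2
  have p1 := Real.sqrt_nonneg (S - 2 * D)
  have p2 := Real.sqrt_nonneg (S + 2 * D)
  set r := √(S - 2 * D)
  set s := √(S + 2 * D)
  have hsum : r ^ 2 + s ^ 2 = 2 * S := by linarith
  have hprod : (r * s) ^ 2 = S ^ 2 - 4 * D ^ 2 := by rw [mul_pow, q1, q2]; ring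
  have hrs : 0 ≤ r * s := mul_nonneg p1 p2
  constructor
  · intro h
    have h4 : (r + s) ^ 2 ≤ 4 := by nlinarith
    have h5 : r * s ≤ 2 - S := by nlinarith
    have h6 : (r * s) ^ 2 ≤ (2 - S) ^ 2 := by gcongr
    exact ⟨by linarith, by nlinarith⟩
  · rintro ⟨hS2, hSD⟩
    have h5 : r * s ≤ 2 - S := abs_le_of_sq_le_sq' (by nlinarith) (by linarith) |>.2
    have h4 : (r + s) ^ 2 ≤ 2 ^ 2 := by nlinarith
    exact abs_le_of_sq_le_sq' h4 (by norm_num) |>.2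

theorem quad_eq (α β T11 T12 T21 T22 : ℝ) (hα : Real.sin α ≠ 0) (hβ : Real.sin β ≠ 0) :
    quadForm α β ![T11, cos α * T11 + sin α * T21, cos β * T11 + sin β * T12,
      cos α * (cos β * T11 + sin β * T12) + sin α * (cos β * T21 + sin β * T22)] =
    (T11 - T22) ^ 2 + (T12 + T21) ^ 2 := by
  have ca : cos α ^ 2 = 1 - sin α ^ 2 := by rw [Real.cos_sq']
  have cb : cos β ^ 2 = 1 - sin β ^ 2 := by rw [Real.cos_sq']
  simp only [quadForm, Fmat, Matrix.smul_mulVec, dotProduct_smul, Real.cos_add, Real.cos_sub]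
  simp [dotProduct, Matrix.mulVec, Fin.sum_univ_four]
  generalize cos α = c at *
  generalize sin α = s at *
  generalize cos β = d at *
  generalize sin β = t at *
  have ca3 : c ^ 3 = c * (1 - s ^ 2) := by rw [← ca]; ring
  have ca4 : c ^ 4 = (1 - s ^ 2) ^ 2 := by rw [← ca]; ring
  have cb3 : d ^ 3 = d * (1 - t ^ 2) := by rw [← cb]; ring
  have cb4 : d ^ 4 = (1 - t ^ 2) ^ 2 := by rw [← cb]; ring
  field_simp
  ring_nf
  simp only [ca, ca3, ca4, cb, cb3, cb4]
  ring

theorem dotSigma_herm (a : Fin 3 → ℝ) : (dotSigma a)ᴴ = dotSigma a := by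
  ext i j
  fin_cases i <;> fin_cases j <;> simp [dotSigma, σ1, σ2, σ3]

theorem dotSigma_trace (a : Fin 3 → ℝ) : (dotSigma a).trace = 0 := by
  simp [dotSigma, σ1, σ2, σ3, Matrix.trace_fin_two]

theorem dotSigma_anticomm (a b : Fin 3 → ℝ) :
    dotSigma b * dotSigma a = ((2 * dot3 a b : ℝ) : ℂ) • 1 - dotSigma a * dotSigma b := by
  ext i j
  fin_cases i <;> fin_cases j <;>
    simp [dotSigma, σ1, σ2, σ3, Matrix.mul_apply, dot3] <;> ring_nf <;>
    simp only [Complex.I_sq] <;> ring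

theorem dotSigma_sq (a : Fin 3 → ℝ) (h : dot3 a a = 1) : dotSigma a * dotSigma a = 1 := by
  have h1 := dotSigma_anticomm a a
  rw [h, eq_sub_iff_add_eq, ← two_smul ℂ] at h1
  have h2 := congrArg (fun X => (1 / 2 : ℂ) • X) h1
  simpa [smul_smul] using h2

theorem cliff_of (a b : Fin 3 → ℝ) (c s : ℝ) (ha : dot3 a a = 1) (hb : dot3 b b = 1)
    (hc : c = dot3 a b) (hs : s ≠ 0) (hcs : s ^ 2 + c ^ 2 = 1) :
    CliffPair (dotSigma a) ((1 / s : ℂ) • (dotSigma b - (c : ℂ) • dotSigma a)) where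
  h1 := dotSigma_herm a
  h2 := by simp [dotSigma_herm]
  s1 := dotSigma_sq a ha
  s2 := by
    have hsc : (s : ℂ) ≠ 0 := by exact_mod_cast hs
    have hcsc : (s : ℂ) ^ 2 + (c : ℂ) ^ 2 = 1 := by exact_mod_cast hcs
    simp only [Matrix.smul_mul, Matrix.mul_smul, Matrix.sub_mul, Matrix.mul_sub, dotSigma_sq a ha,
      dotSigma_sq b hb, dotSigma_anticomm a b, ← hc]
    push_cast
    match_scalars
    · field_simp
      linear_combination -hcsc
    · ring
  ac := by
    simp only [Matrix.smul_mul, Matrix.mul_smul, Matrix.sub_mul, Matrix.mul_sub, dotSigma_sq a ha,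
      dotSigma_anticomm a b, ← hc]
    push_cast
    module
  t1 := dotSigma_trace a
  t2 := by simp [dotSigma_trace]

/-- For unit vectors `a₁,a₂,b₁,b₂ ∈ ℝ³` with angles `α, β ∈ (0,π)`,
a density matrix reproducing the correlations `γᵢⱼ = Tr[ρ (Aᵢ ⊗ Bⱼ)]` exists iff
`√(γᵀ F_{α,β} γ) + √(γᵀ F_{α,−β} γ) ≤ 2`. -/
theorem stmt0 (a₁ a₂ b₁ b₂ : Fin 3 → ℝ)
    (ha₁ : dot3 a₁ a₁ = 1) (ha₂ : dot3 a₂ a₂ = 1)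
    (hb₁ : dot3 b₁ b₁ = 1) (hb₂ : dot3 b₂ b₂ = 1)
    (α β : ℝ) (hα : α ∈ Set.Ioo 0 π) (hβ : β ∈ Set.Ioo 0 π)
    (hcα : Real.cos α = dot3 a₁ a₂) (hcβ : Real.cos β = dot3 b₁ b₂)
    (γ11 γ21 γ12 γ22 : ℝ) :
    (∃ ρ : Matrix (Fin 2 × Fin 2) (Fin 2 × Fin 2) ℂ, IsDensityMatrix ρ ∧
        (ρ * (dotSigma a₁ ⊗ₖ dotSigma b₁)).trace = (γ11 : ℂ) ∧
        (ρ * (dotSigma a₂ ⊗ₖ dotSigma b₁)).trace = (γ21 : ℂ) ∧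
        (ρ * (dotSigma a₁ ⊗ₖ dotSigma b₂)).trace = (γ12 : ℂ) ∧
        (ρ * (dotSigma a₂ ⊗ₖ dotSigma b₂)).trace = (γ22 : ℂ)) ↔
      Real.sqrt (quadForm α β ![γ11, γ21, γ12, γ22]) +
        Real.sqrt (quadForm α (-β) ![γ11, γ21, γ12, γ22]) ≤ 2 := by
  have hsα : sin α ≠ 0 := (Real.sin_pos_of_mem_Ioo hα).ne'
  have hsβ : sin β ≠ 0 := (Real.sin_pos_of_mem_Ioo hβ).ne'
  have hE := cliff_of a₁ a₂ _ _ ha₁ ha₂ hcα hsα (Real.sin_sq_add_cos_sq α)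
  have hF := cliff_of b₁ b₂ _ _ hb₁ hb₂ hcβ hsβ (Real.sin_sq_add_cos_sq β)
  have hsαc : (sin α : ℂ) ≠ 0 := by exact_mod_cast hsα
  have hsβc : (sin β : ℂ) ≠ 0 := by exact_mod_cast hsβ
  set E1 := dotSigma a₁
  set F1 := dotSigma b₁
  set E2 := (1 / (sin α : ℂ)) • (dotSigma a₂ - (cos α : ℂ) • E1) with hE2
  set F2 := (1 / (sin β : ℂ)) • (dotSigma b₂ - (cos β : ℂ) • F1) with hF2
  have eA : dotSigma a₂ = (cos α : ℂ) • E1 + (sin α : ℂ) • E2 := by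
    rw [hE2, smul_smul, mul_one_div_cancel hsαc]; simp
  have eB : dotSigma b₂ = (cos β : ℂ) • F1 + (sin β : ℂ) • F2 := by
    rw [hF2, smul_smul, mul_one_div_cancel hsβc]; simp
  obtain ⟨T11, h11⟩ : ∃ T11 : ℝ, T11 = γ11 := ⟨_, rfl⟩
  obtain ⟨T21, h21⟩ : ∃ T21 : ℝ, cos α * T11 + sin α * T21 = γ21 :=
    ⟨(γ21 - cos α * T11) / sin α, by field_simp; ring⟩
  obtain ⟨T12, h12⟩ : ∃ T12 : ℝ, cos β * T11 + sin β * T12 = γ12 :=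
    ⟨(γ12 - cos β * T11) / sin β, by field_simp; ring⟩
  obtain ⟨T22, h22⟩ : ∃ T22 : ℝ, cos α * (cos β * T11 + sin β * T12)
      + sin α * (cos β * T21 + sin β * T22) = γ22 :=
    ⟨((γ22 - cos α * (cos β * T11 + sin β * T12)) / sin α - cos β * T21) / sin β,
      by field_simp; ring⟩
  subst h11 h21 h12 h22
  have q1 := quad_eq α β T11 T12 T21 T22 hsα hsβ
  have q2 := quad_eq α (-β) T11 (-T12) T21 (-T22) hsα (by simpa using hsβ)
  simp only [Real.cos_neg, Real.sin_neg, neg_mul_neg] at q2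
  have q2' : (T11 - -T22) ^ 2 + (-T12 + T21) ^ 2 = (T11 + T22) ^ 2 + (T12 - T21) ^ 2 := by ring
  rw [q1, q2, q2', sqrt_cond]
  rw [eA, eB]
  simp only [Matrix.add_kronecker, Matrix.kronecker_add, Matrix.smul_kronecker,
    Matrix.kronecker_smul, Matrix.mul_add, Matrix.mul_smul, Matrix.trace_add, Matrix.trace_smul,
    smul_eq_mul, smul_add]
  simp only [Complex.ofReal_add, Complex.ofReal_mul]
  constructor
  · rintro ⟨ρ, hρ, g11, g21, g12, g22⟩
    have k21 : (ρ * (E2 ⊗ₖ F1)).trace = (T21 : ℂ) := by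
      apply mul_left_cancel₀ hsαc
      linear_combination g21 - (cos α : ℂ) * g11
    have k12 : (ρ * (E1 ⊗ₖ F2)).trace = (T12 : ℂ) := by
      apply mul_left_cancel₀ hsβc
      linear_combination g12 - (cos β : ℂ) * g11
    have k22 : (ρ * (E2 ⊗ₖ F2)).trace = (T22 : ℂ) := by
      apply mul_left_cancel₀ (mul_ne_zero hsαc hsβc)
      rw [g11, k21, k12] at g22
      linear_combination g22
    exact necessity hE hF _ _ _ _ ρ hρ g11 k12 k21 k22
  · rintro ⟨hS, hD⟩
    obtain ⟨ρ, hρ, k11, k12, k21, k22⟩ := exists_rho hE hF _ _ _ _ hS hD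
    refine ⟨ρ, hρ, k11, ?_, ?_, ?_⟩
    · rw [k11, k21]
    · rw [k11, k12]
    · rw [k11, k12, k21, k22]; ring
end
end

section
/- Set A₁ := σ₁, A₂ := σ₂, B₁ := σ₁, B₂ := σ₂ (pairs of anti-commuting ±1-valued observables). Then for real numbers C₁₁, C₂₁, C₁₂, C₂₂, there exists a density matrix ρ on ℂ²⊗ℂ² with Tr[ρ (A_i ⊗ B_j)] = C_{ij} for all i, j ∈ {1,2} if and only if √((C₁₁+C₂₂)² + (C₁₂−C₂₁)²) + √((C₁₁−C₂₂)² + (C₁₂+C₂₁)²) ≤ 2. Moreover, when this inequality holds, ρ can be chosen so that additionally Tr[ρ (A_i ⊗ I₂)] = 0 and Tr[ρ (I₂ ⊗ B_j)] = 0 for all i, j ∈ {1,2}. -/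
open Matrix Kronecker Real ComplexOrder

noncomputable section

lemma psd_offdiag_bound {n : Type*} [Fintype n] [DecidableEq n] {ρ : Matrix n n ℂ}
    (h : ρ.PosSemidef) (i j : n) :
    2 * ‖ρ i j‖ ≤ (ρ i i).re + (ρ j j).re := by
  have hs := h.submatrix ![i, j]
  have hd := hs.det_nonneg
  have hi := h.diag_nonneg (i := i)
  have hj := h.diag_nonneg (i := j)
  have hji : ρ j i = star (ρ i j) := (h.1.apply j i).symm
  rw [Matrix.det_fin_two] at hd
  simp only [Matrix.submatrix_apply, Matrix.cons_val_zero, Matrix.cons_val_one, hji] at hd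
  rw [Complex.le_def] at hi hj hd
  have hd1 := hd.1
  simp only [Complex.sub_re, Complex.mul_re, Complex.zero_re, Complex.zero_im, RCLike.star_def,
    Complex.conj_re, Complex.conj_im, ← hi.2, ← hj.2] at hd1
  have hn : ‖ρ i j‖ ^ 2 = (ρ i j).re ^ 2 + (ρ i j).im ^ 2 := by
    rw [Complex.sq_norm, Complex.normSq_apply]; ring
  have h1 := hi.1
  have h2 := hj.1
  simp only [Complex.zero_re] at h1 h2
  refine abs_le_of_sq_le_sq' ?_ (by linarith) |>.2
  nlinarith [sq_nonneg ((ρ i i).re - (ρ j j).re)]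

lemma exists_unit_polar (x : ℂ) : ∃ e : ℂ, e * star e = 1 ∧ (‖x‖ : ℂ) * e = x := by
  refine ⟨Complex.exp (x.arg * Complex.I), ?_, Complex.norm_mul_exp_arg_mul_I x⟩
  rw [RCLike.star_def, Complex.mul_conj, Complex.normSq_eq_norm_sq,
    Complex.norm_exp_ofReal_mul_I]
  simp

lemma norm_mk4 (a b : ℝ) : ‖(⟨a / 4, b / 4⟩ : ℂ)‖ = Real.sqrt (a ^ 2 + b ^ 2) / 4 := by
  rw [Complex.norm_def, Complex.normSq_mk,
    show a / 4 * (a / 4) + b / 4 * (b / 4) = (a ^ 2 + b ^ 2) / 4 ^ 2 by ring,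
    Real.sqrt_div (by positivity), Real.sqrt_sq (by norm_num)]

/-- The vector `e|00⟩ + |11⟩`. -/
def wEven (e : ℂ) : Fin 2 × Fin 2 → ℂ := fun p => !![e, 0; 0, 1] p.1 p.2

/-- The vector `e|01⟩ + |10⟩`. -/
def wOdd (e : ℂ) : Fin 2 × Fin 2 → ℂ := fun p => !![0, e; 1, 0] p.1 p.2

lemma stmt4_suff (C11 C21 C12 C22 : ℝ)
    (h : Real.sqrt ((C11 + C22) ^ 2 + (C12 - C21) ^ 2) +
        Real.sqrt ((C11 - C22) ^ 2 + (C12 + C21) ^ 2) ≤ 2) :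
      ∃ ρ : Matrix (Fin 2 × Fin 2) (Fin 2 × Fin 2) ℂ, IsDensityMatrix ρ ∧
        (ρ * (σ1 ⊗ₖ σ1)).trace = (C11 : ℂ) ∧
        (ρ * (σ2 ⊗ₖ σ1)).trace = (C21 : ℂ) ∧
        (ρ * (σ1 ⊗ₖ σ2)).trace = (C12 : ℂ) ∧
        (ρ * (σ2 ⊗ₖ σ2)).trace = (C22 : ℂ) ∧
        (ρ * (σ1 ⊗ₖ (1 : Matrix (Fin 2) (Fin 2) ℂ))).trace = 0 ∧
        (ρ * (σ2 ⊗ₖ (1 : Matrix (Fin 2) (Fin 2) ℂ))).trace = 0 ∧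
        (ρ * ((1 : Matrix (Fin 2) (Fin 2) ℂ) ⊗ₖ σ1)).trace = 0 ∧
        (ρ * ((1 : Matrix (Fin 2) (Fin 2) ℂ) ⊗ₖ σ2)).trace = 0 := by
  have hu := norm_mk4 (C11 + C22) (C12 - C21)
  have hv := norm_mk4 (C11 - C22) (-(C12 + C21))
  rw [neg_sq] at hv
  set y : ℂ := ⟨(C11 + C22) / 4, (C12 - C21) / 4⟩ with hy
  set x : ℂ := ⟨(C11 - C22) / 4, -(C12 + C21) / 4⟩ with hx
  obtain ⟨e, he, hex⟩ := exists_unit_polar x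
  obtain ⟨f, hf, hfy⟩ := exists_unit_polar y
  have hex' : (‖x‖ : ℂ) * star e = star x := by
    conv_rhs => rw [← hex]
    simp [mul_comm]
  have hfy' : (‖y‖ : ℂ) * star f = star y := by
    conv_rhs => rw [← hfy]
    simp [mul_comm]
  have ht : 0 ≤ (1 - 2 * ‖x‖ - 2 * ‖y‖) / 4 := by linarith
  have hC11 : (C11 : ℂ) = x + star x + y + star y := by
    apply Complex.ext <;> simp [hx, hy]
    ring
  have hC22 : (C22 : ℂ) = -x - star x + y + star y := by
    apply Complex.ext <;> simp [hx, hy]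
    ring
  have hC12 : (C12 : ℂ) = Complex.I * (x - star x - y + star y) := by
    apply Complex.ext <;> simp [hx, hy]
    ring
  have hC21 : (C21 : ℂ) = Complex.I * (x - star x + y - star y) := by
    apply Complex.ext <;> simp [hx, hy]
    ring
  have hI := Complex.I_mul_I
  refine ⟨(‖x‖ : ℂ) • vecMulVec (wEven e) (star (wEven e)) +
    (‖y‖ : ℂ) • vecMulVec (wOdd f) (star (wOdd f)) +
    (((1 - 2 * ‖x‖ - 2 * ‖y‖) / 4 : ℝ) : ℂ) • (1 : Matrix _ _ ℂ), ⟨?_, ?_⟩, ?_⟩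
  · refine ((posSemidef_vecMulVec_self_star _).smul ?_).add
      ((posSemidef_vecMulVec_self_star _).smul ?_) |>.add (PosSemidef.one.smul ?_)
    · exact_mod_cast norm_nonneg x
    · exact_mod_cast norm_nonneg y
    · exact_mod_cast ht
  all_goals generalize (‖x‖ : ℝ) = v at *
  all_goals generalize (‖y‖ : ℝ) = u at *
  all_goals clear_value x y
  · simp [Matrix.trace, Fintype.sum_prod_type, vecMulVec_apply, wEven, wOdd] at he hf ⊢
    linear_combination (v : ℂ) * he + u * hf
  · rw [hC11, hC22, hC12, hC21]
    refine ⟨?_, ?_, ?_, ?_, ?_, ?_, ?_, ?_⟩ <;>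
    simp [Matrix.trace, Matrix.mul_apply, Fintype.sum_prod_type, vecMulVec_apply, wEven, wOdd,
      σ1, σ2, Matrix.one_apply] at hex hex' hfy hfy' ⊢ <;> 
    grind

/-- For the anti-commuting observables `A₁ = B₁ = σ₁`, `A₂ = B₂ = σ₂`,
the correlations `Cᵢⱼ` are quantum realizable iff
`√((C₁₁+C₂₂)² + (C₁₂−C₂₁)²) + √((C₁₁−C₂₂)² + (C₁₂+C₂₁)²) ≤ 2`; moreover when the
inequality holds, `ρ` can be chosen with vanishing marginal expectation values. -/
theorem stmt4 (C11 C21 C12 C22 : ℝ) :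
    ((∃ ρ : Matrix (Fin 2 × Fin 2) (Fin 2 × Fin 2) ℂ, IsDensityMatrix ρ ∧
        (ρ * (σ1 ⊗ₖ σ1)).trace = (C11 : ℂ) ∧
        (ρ * (σ2 ⊗ₖ σ1)).trace = (C21 : ℂ) ∧
        (ρ * (σ1 ⊗ₖ σ2)).trace = (C12 : ℂ) ∧
        (ρ * (σ2 ⊗ₖ σ2)).trace = (C22 : ℂ)) ↔
      Real.sqrt ((C11 + C22) ^ 2 + (C12 - C21) ^ 2) +
        Real.sqrt ((C11 - C22) ^ 2 + (C12 + C21) ^ 2) ≤ 2) ∧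
    (Real.sqrt ((C11 + C22) ^ 2 + (C12 - C21) ^ 2) +
        Real.sqrt ((C11 - C22) ^ 2 + (C12 + C21) ^ 2) ≤ 2 →
      ∃ ρ : Matrix (Fin 2 × Fin 2) (Fin 2 × Fin 2) ℂ, IsDensityMatrix ρ ∧
        (ρ * (σ1 ⊗ₖ σ1)).trace = (C11 : ℂ) ∧
        (ρ * (σ2 ⊗ₖ σ1)).trace = (C21 : ℂ) ∧
        (ρ * (σ1 ⊗ₖ σ2)).trace = (C12 : ℂ) ∧
        (ρ * (σ2 ⊗ₖ σ2)).trace = (C22 : ℂ) ∧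
        (ρ * (σ1 ⊗ₖ (1 : Matrix (Fin 2) (Fin 2) ℂ))).trace = 0 ∧
        (ρ * (σ2 ⊗ₖ (1 : Matrix (Fin 2) (Fin 2) ℂ))).trace = 0 ∧
        (ρ * ((1 : Matrix (Fin 2) (Fin 2) ℂ) ⊗ₖ σ1)).trace = 0 ∧
        (ρ * ((1 : Matrix (Fin 2) (Fin 2) ℂ) ⊗ₖ σ2)).trace = 0) := by
  refine ⟨⟨?_, fun h => ?_⟩, stmt4_suff C11 C21 C12 C22⟩
  · rintro ⟨ρ, ⟨hρ, htr⟩, h11, h21, h12, h22⟩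
    have b1 := psd_offdiag_bound hρ (0, 0) (1, 1)
    have b2 := psd_offdiag_bound hρ (0, 1) (1, 0)
    have e1 : ρ (1, 1) (0, 0) = star (ρ (0, 0) (1, 1)) := (hρ.1.apply _ _).symm
    have e2 : ρ (1, 0) (0, 1) = star (ρ (0, 1) (1, 0)) := (hρ.1.apply _ _).symm
    simp [Matrix.trace, Matrix.mul_apply, Fintype.sum_prod_type, σ1, σ2, e1, e2]
      at htr h11 h21 h12 h22
    have t := congrArg Complex.re htr
    have k11 := congrArg Complex.re h11
    have k21 := congrArg Complex.re h21
    have k12 := congrArg Complex.re h12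
    have k22 := congrArg Complex.re h22
    simp at t k11 k21 k12 k22
    have hu := norm_mk4 (C11 + C22) (C12 - C21)
    have hv := norm_mk4 (C11 - C22) (-(C12 + C21))
    rw [neg_sq] at hv
    have hy : (⟨(C11 + C22) / 4, (C12 - C21) / 4⟩ : ℂ) = ρ (0, 1) (1, 0) := by
      apply Complex.ext <;> simp <;> linarith
    have hx : (⟨(C11 - C22) / 4, -(C12 + C21) / 4⟩ : ℂ) = ρ (0, 0) (1, 1) := by
      apply Complex.ext <;> simp <;> linarith
    rw [hy] at hu
    rw [hx] at hv
    linarith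
  · obtain ⟨ρ, h0, h1, h2, h3, h4, -⟩ := stmt4_suff C11 C21 C12 C22 h
    exact ⟨ρ, h0, h1, h2, h3, h4⟩
end
end

section
/- For all real numbers C₁₁, C₂₁, C₁₂, C₂₂, if √((C₁₁+C₂₂)² + (C₁₂−C₂₁)²) + √((C₁₁−C₂₂)² + (C₁₂+C₂₁)²) ≤ 2, then Tsirel'son's inequalities hold: for all k, l ∈ {1,2}, |C₁₁ + C₁₂ + C₂₁ + C₂₂ − 2·C_{kl}| ≤ 2√2. -/
open Real

theorem abs_le_aux (x a b : ℝ) (hs : Real.sqrt (a ^ 2 + b ^ 2) ≤ 2)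
    (hx : x = a + b ∨ x = a - b ∨ x = b - a) : |x| ≤ 2 * Real.sqrt 2 := by
  have h4 : a ^ 2 + b ^ 2 ≤ 2 ^ 2 := (Real.sqrt_le_left (by norm_num)).1 hs
  have h2 : Real.sqrt 2 ^ 2 = 2 := Real.sq_sqrt (by norm_num)
  apply abs_le_of_sq_le_sq _ (by positivity)
  rw [mul_pow, h2]
  rcases hx with rfl | rfl | rfl <;> nlinarith [sq_nonneg (a + b), sq_nonneg (a - b)]

/-- The quantum condition for anti-commuting observables implies
Tsirel'son's inequalities. Here `C k l` is the family `(C₁₁, C₂₁, C₁₂, C₂₂)` with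
first index for Alice and second for Bob (zero-based: `C 0 0 = C₁₁`, `C 1 0 = C₂₁`,
`C 0 1 = C₁₂`, `C 1 1 = C₂₂`). -/
theorem stmt5 (C : Fin 2 → Fin 2 → ℝ)
    (h : Real.sqrt ((C 0 0 + C 1 1) ^ 2 + (C 0 1 - C 1 0) ^ 2) +
        Real.sqrt ((C 0 0 - C 1 1) ^ 2 + (C 0 1 + C 1 0) ^ 2) ≤ 2) :
    ∀ k l : Fin 2,
      |C 0 0 + C 0 1 + C 1 0 + C 1 1 - 2 * C k l| ≤ 2 * Real.sqrt 2 := by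
  have p := Real.sqrt_nonneg ((C 0 0 + C 1 1) ^ 2 + (C 0 1 - C 1 0) ^ 2)
  have q := Real.sqrt_nonneg ((C 0 0 - C 1 1) ^ 2 + (C 0 1 + C 1 0) ^ 2)
  rw [Fin.forall_fin_two, Fin.forall_fin_two, Fin.forall_fin_two]
  refine ⟨⟨?_, ?_⟩, ?_, ?_⟩
  · exact abs_le_aux _ (C 0 0 - C 1 1) (C 0 1 + C 1 0) (by linarith) (by right; right; ring)
  · exact abs_le_aux _ (C 0 0 + C 1 1) (C 0 1 - C 1 0) (by linarith) (by right; left; ring)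
  · exact abs_le_aux _ (C 0 0 + C 1 1) (C 0 1 - C 1 0) (by linarith) (by left; ring)
  · exact abs_le_aux _ (C 0 0 - C 1 1) (C 0 1 + C 1 0) (by linarith) (by left; ring)
end

section
/- Let a₁, a₂, b₁, b₂ ∈ ℝ³ be unit vectors with a₁ × a₂ ≠ 0 and b₁ × b₂ ≠ 0. Set A_i := a_i·σ, B_j := b_j·σ for i, j ∈ {1,2}, A₃ := ((a₁ × a₂)/‖a₁ × a₂‖)·σ, B₃ := ((b₁ × b₂)/‖b₁ × b₂‖)·σ, and X₁ := A₁⊗I₂, X₂ := A₂⊗I₂, X₃ := I₂⊗B₁, X₄ := I₂⊗B₂ (4×4 matrices). Then there exists a linear map T on the space of 4×4 complex matrices such that: (1) whenever ρ is a density matrix, T(ρ) is a density matrix; (2) Tr[T(ρ) X_i X_{j+2}] = Tr[ρ X_i X_{j+2}] for all i, j ∈ {1,2}; (3) Tr[T(ρ) (A₃ ⊗ B₃)] = Tr[ρ (A₃ ⊗ B₃)]; (4) Tr[T(ρ) X_i] = 0 for all i ∈ {1,2,3,4}; (5) Tr[T(ρ) X_i X_j X_k] = 0 for all 1 ≤ i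 < j < k ≤ 4; (6) Tr[T(ρ) (A₃ ⊗ I₂)] = 0 and Tr[T(ρ) (I₂ ⊗ B₃)] = 0. -/
open Matrix Kronecker Real ComplexOrder

noncomputable section

/-- The cross product on `ℝ³`. -/
def cross3 (a b : Fin 3 → ℝ) : Fin 3 → ℝ :=
  ![a 1 * b 2 - a 2 * b 1, a 2 * b 0 - a 0 * b 2, a 0 * b 1 - a 1 * b 0]

/-- The Euclidean norm on `ℝ³`. -/
def norm3 (a : Fin 3 → ℝ) : ℝ := Real.sqrt (dot3 a a)

/-- The normalization `v/‖v‖` of a vector in `ℝ³`. -/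
def unit3 (v : Fin 3 → ℝ) : Fin 3 → ℝ := fun i => v i / norm3 v


abbrev M2 := Matrix (Fin 2) (Fin 2) ℂ
abbrev M4 := Matrix (Fin 2 × Fin 2) (Fin 2 × Fin 2) ℂ

lemma aux_sandwich (n a : Fin 3 → ℝ) (hn : dot3 n n = 1) (h : dot3 n a = 0) :
    dotSigma n * dotSigma a * dotSigma n = - dotSigma a := by
  have hn' : (n 0 : ℂ) * n 0 + n 1 * n 1 + n 2 * n 2 = 1 := by
    unfold dot3 at hn; exact_mod_cast hn
  have h' : (n 0 : ℂ) * a 0 + n 1 * a 1 + n 2 * a 2 = 0 := by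
    unfold dot3 at h; exact_mod_cast h
  have hI : Complex.I ^ 2 = -1 := Complex.I_sq
  ext i j
  fin_cases i <;> fin_cases j <;>
    simp [dotSigma, σ1, σ2, σ3, Matrix.mul_apply, Fin.sum_univ_two] <;> grind

lemma aux_sq (n : Fin 3 → ℝ) (hn : dot3 n n = 1) :
    dotSigma n * dotSigma n = 1 := by
  have hn' : (n 0 : ℂ) * n 0 + n 1 * n 1 + n 2 * n 2 = 1 := by
    unfold dot3 at hn; exact_mod_cast hn
  have hI : Complex.I ^ 2 = -1 := Complex.I_sq
  ext i j
  fin_cases i <;> fin_cases j <;>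
    simp [dotSigma, σ1, σ2, σ3, Matrix.mul_apply, Fin.sum_univ_two] <;> grind

lemma aux_herm (n : Fin 3 → ℝ) : (dotSigma n)ᴴ = dotSigma n := by
  ext i j
  fin_cases i <;> fin_cases j <;>
    simp [dotSigma, σ1, σ2, σ3, Matrix.conjTranspose_apply]

/-- spin flip on one qubit -/
lemma aux_flip (a : Fin 3 → ℝ) : (σ2 * dotSigma a * σ2)ᵀ = - dotSigma a := by
  have hI : Complex.I ^ 2 = -1 := Complex.I_sq
  ext i j
  fin_cases i <;> fin_cases j <;>
    simp [dotSigma, σ1, σ2, σ3, Matrix.mul_apply, Fin.sum_univ_two] <;> grind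

lemma aux_flip_one : (σ2 * (1 : M2) * σ2)ᵀ = 1 := by
  ext i j
  fin_cases i <;> fin_cases j <;>
    simp [σ2, Matrix.mul_apply, Fin.sum_univ_two]

lemma aux_s2_herm : σ2ᴴ = σ2 := by
  ext i j
  fin_cases i <;> fin_cases j <;> simp [σ2, Matrix.conjTranspose_apply]

lemma aux_s2_sq : σ2 * σ2 = 1 := by
  ext i j
  fin_cases i <;> fin_cases j <;> simp [σ2, Matrix.mul_apply, Fin.sum_univ_two]

def V4 : M4 := σ2 ⊗ₖ σ2

/-- total spin flip -/
def flip4 (M : M4) : M4 := (V4 * M * V4)ᵀ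

lemma V4_herm : V4ᴴ = V4 := by
  rw [V4, conjTranspose_kronecker, aux_s2_herm]

lemma V4_transpose : V4ᵀ = V4 := by
  have h : σ2ᵀ = -σ2 := by
    ext i j
    fin_cases i <;> fin_cases j <;> simp [σ2]
  ext ⟨i, j⟩ ⟨k, l⟩
  have h1 := congrFun (congrFun h i) k
  have h2 := congrFun (congrFun h j) l
  simp only [Matrix.transpose_apply, Matrix.neg_apply] at h1 h2
  simp [V4, Matrix.transpose_apply, h1, h2]

lemma V4_sq : V4 * V4 = 1 := by
  rw [V4, ← mul_kronecker_mul, aux_s2_sq, one_kronecker_one]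

lemma flip4_kron (P Q : M2) : flip4 (P ⊗ₖ Q) = (σ2 * P * σ2)ᵀ ⊗ₖ (σ2 * Q * σ2)ᵀ := by
  rw [flip4, V4, ← mul_kronecker_mul, ← mul_kronecker_mul]
  rfl

def Tmap (U : M4) : M4 →ₗ[ℂ] M4 where
  toFun ρ := (1 / 4 : ℂ) • ((ρ + flip4 ρ) + U * (ρ + flip4 ρ) * U)
  map_add' x y := by
    simp only [flip4, mul_add, add_mul, transpose_add]
    rw [← smul_add]; congr 1; abel
  map_smul' c x := by
    simp only [flip4, mul_add, add_mul, transpose_smul, mul_smul_comm, smul_mul_assoc,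
      RingHom.id_apply, smul_add, smul_comm c]

lemma Tmap_apply (U ρ : M4) :
    Tmap U ρ = (1 / 4 : ℂ) • ((ρ + flip4 ρ) + U * (ρ + flip4 ρ) * U) := rfl

lemma trace_flip4 (ρ M : M4) : (flip4 ρ * M).trace = (ρ * flip4 M).trace := by
  rw [← trace_transpose, transpose_mul, flip4, flip4, transpose_transpose,
    transpose_mul, transpose_mul, V4_transpose, trace_mul_comm]
  simp only [Matrix.mul_assoc]
  rw [trace_mul_comm]
  simp only [Matrix.mul_assoc]

lemma trace_conj (U R M : M4) : (U * R * U * M).trace = (R * (U * M * U)).trace := by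
  simp only [Matrix.mul_assoc]
  rw [trace_mul_comm]
  simp only [Matrix.mul_assoc]

lemma Tmap_trace (U ρ M : M4) : (Tmap U ρ * M).trace =
    (1 / 4 : ℂ) * ((ρ * M).trace + (ρ * flip4 M).trace + (ρ * (U * M * U)).trace
      + (ρ * flip4 (U * M * U)).trace) := by
  rw [Tmap_apply, smul_mul_assoc, trace_smul, add_mul, trace_add, trace_conj, add_mul, add_mul,
    trace_add, trace_add, trace_flip4, trace_flip4, smul_eq_mul]
  ring

lemma flip4_neg (M : M4) : flip4 (-M) = - flip4 M := by simp [flip4]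

lemma Tmap_trace_zero (U ρ M : M4) (h : U * M * U = -M) : (Tmap U ρ * M).trace = 0 := by
  rw [Tmap_trace, h, flip4_neg, mul_neg, mul_neg, trace_neg, trace_neg]
  ring

lemma Tmap_trace_zero' (U ρ M : M4) (h : U * M * U = M) (h' : flip4 M = -M) :
    (Tmap U ρ * M).trace = 0 := by
  rw [Tmap_trace, h, h', mul_neg, trace_neg]
  ring

lemma Tmap_trace_eq (U ρ M : M4) (h : U * M * U = M) (h' : flip4 M = M) :
    (Tmap U ρ * M).trace = (ρ * M).trace := by
  rw [Tmap_trace, h, h']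
  ring

lemma flip4_one : flip4 1 = 1 := by
  rw [flip4, mul_one, V4_sq, transpose_one]

lemma Tmap_density (U ρ : M4) (hU : Uᴴ = U) (hU2 : U * U = 1) (h : IsDensityMatrix ρ) :
    IsDensityMatrix (Tmap U ρ) := by
  obtain ⟨hp, ht⟩ := h
  constructor
  · have h1 : (flip4 ρ).PosSemidef := by
      have := hp.mul_mul_conjTranspose_same V4
      rw [V4_herm] at this
      exact this.transpose
    have h2 := hp.add h1
    have h3 := h2.mul_mul_conjTranspose_same U
    rw [hU] at h3
    rw [Tmap_apply]
    refine (h2.add h3).smul ?_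
    have : (0 : ℝ) ≤ 1 / 4 := by norm_num
    have h4 : (0 : ℂ) ≤ ((1 / 4 : ℝ) : ℂ) := by exact_mod_cast this
    simpa using h4
  · have := Tmap_trace_eq U ρ 1 (by rw [mul_one, hU2]) flip4_one
    rw [mul_one, mul_one] at this
    rw [this, ht]

lemma unit3_unit (v : Fin 3 → ℝ) (hv : v ≠ 0) : dot3 (unit3 v) (unit3 v) = 1 := by
  have hpos : 0 < dot3 v v := by
    rcases lt_or_eq_of_le (show 0 ≤ dot3 v v by unfold dot3; nlinarith [mul_self_nonneg (v 0), mul_self_nonneg (v 1), mul_self_nonneg (v 2)]) with h | h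
    · exact h
    · exfalso
      apply hv
      unfold dot3 at h
      ext i
      fin_cases i <;> simp <;>
        nlinarith [mul_self_nonneg (v 0), mul_self_nonneg (v 1), mul_self_nonneg (v 2)]
  have h2 : norm3 v * norm3 v = dot3 v v := Real.mul_self_sqrt hpos.le
  have h3 : dot3 (unit3 v) (unit3 v) = dot3 v v / (norm3 v * norm3 v) := by
    unfold unit3
    simp only [dot3]
    ring
  rw [h3, h2, div_self hpos.ne']

lemma unit3_orth (v a : Fin 3 → ℝ) (h : dot3 v a = 0) : dot3 (unit3 v) a = 0 := by
  have : dot3 (unit3 v) a = dot3 v a / norm3 v := by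
    unfold unit3
    simp only [dot3]
    ring
  rw [this, h, zero_div]

lemma cross3_orth1 (a b : Fin 3 → ℝ) : dot3 (cross3 a b) a = 0 := by
  simp [dot3, cross3]; ring

lemma cross3_orth2 (a b : Fin 3 → ℝ) : dot3 (cross3 a b) b = 0 := by
  simp [dot3, cross3]; ring

lemma kron_conj (A B P Q : M2) :
    (A ⊗ₖ B) * (P ⊗ₖ Q) * (A ⊗ₖ B) = (A * P * A) ⊗ₖ (B * Q * B) := by
  rw [← mul_kronecker_mul, ← mul_kronecker_mul]

lemma sandwich_mul (A P Q : M2) (hA : A * A = 1) (hP : A * P * A = -P) (hQ : A * Q * A = -Q) :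
    A * (P * Q) * A = P * Q := by
  calc A * (P * Q) * A = A * P * (A * A) * Q * A := by rw [hA]; simp only [mul_one, mul_assoc]
    _ = (A * P * A) * (A * Q * A) := by simp only [mul_assoc]
    _ = P * Q := by rw [hP, hQ, neg_mul_neg]

lemma neg_kron_s8 (P Q : M2) : (-P) ⊗ₖ Q = -(P ⊗ₖ Q) := by
  ext ⟨i, j⟩ ⟨k, l⟩; simp

lemma kron_neg_s8 (P Q : M2) : P ⊗ₖ (-Q) = -(P ⊗ₖ Q) := by
  ext ⟨i, j⟩ ⟨k, l⟩; simp

/-- The symmetry-reduction map `T`: given unit vectors with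
`a₁ × a₂ ≠ 0`, `b₁ × b₂ ≠ 0`, setting `A₃ := ((a₁×a₂)/‖a₁×a₂‖)·σ`,
`B₃ := ((b₁×b₂)/‖b₁×b₂‖)·σ`, `X₁ := A₁⊗I`, `X₂ := A₂⊗I`, `X₃ := I⊗B₁`, `X₄ := I⊗B₂`,
there is a linear map `T` sending density matrices to density matrices, preserving
the correlations `Tr[ρ XᵢX_{j+2}]` and `Tr[ρ (A₃⊗B₃)]`, and annihilating all first
moments, all third moments, and `Tr[ρ (A₃⊗I)]`, `Tr[ρ (I⊗B₃)]`. -/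
theorem stmt8 (a₁ a₂ b₁ b₂ : Fin 3 → ℝ)
    (ha₁ : dot3 a₁ a₁ = 1) (ha₂ : dot3 a₂ a₂ = 1)
    (hb₁ : dot3 b₁ b₁ = 1) (hb₂ : dot3 b₂ b₂ = 1)
    (hab : cross3 a₁ a₂ ≠ 0) (hbb : cross3 b₁ b₂ ≠ 0) :
    ∃ T : Matrix (Fin 2 × Fin 2) (Fin 2 × Fin 2) ℂ →ₗ[ℂ]
        Matrix (Fin 2 × Fin 2) (Fin 2 × Fin 2) ℂ,
      (∀ ρ, IsDensityMatrix ρ → IsDensityMatrix (T ρ)) ∧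
      (∀ ρ : Matrix (Fin 2 × Fin 2) (Fin 2 × Fin 2) ℂ, IsDensityMatrix ρ →
        -- (2) correlations Tr[ρ Xᵢ X_{j+2}] are preserved
        ((T ρ * ((dotSigma a₁ ⊗ₖ (1 : Matrix (Fin 2) (Fin 2) ℂ)) *
            ((1 : Matrix (Fin 2) (Fin 2) ℂ) ⊗ₖ dotSigma b₁))).trace =
          (ρ * ((dotSigma a₁ ⊗ₖ (1 : Matrix (Fin 2) (Fin 2) ℂ)) *
            ((1 : Matrix (Fin 2) (Fin 2) ℂ) ⊗ₖ dotSigma b₁))).trace ∧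
        (T ρ * ((dotSigma a₁ ⊗ₖ (1 : Matrix (Fin 2) (Fin 2) ℂ)) *
            ((1 : Matrix (Fin 2) (Fin 2) ℂ) ⊗ₖ dotSigma b₂))).trace =
          (ρ * ((dotSigma a₁ ⊗ₖ (1 : Matrix (Fin 2) (Fin 2) ℂ)) *
            ((1 : Matrix (Fin 2) (Fin 2) ℂ) ⊗ₖ dotSigma b₂))).trace ∧
        (T ρ * ((dotSigma a₂ ⊗ₖ (1 : Matrix (Fin 2) (Fin 2) ℂ)) *
            ((1 : Matrix (Fin 2) (Fin 2) ℂ) ⊗ₖ dotSigma b₁))).trace =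
          (ρ * ((dotSigma a₂ ⊗ₖ (1 : Matrix (Fin 2) (Fin 2) ℂ)) *
            ((1 : Matrix (Fin 2) (Fin 2) ℂ) ⊗ₖ dotSigma b₁))).trace ∧
        (T ρ * ((dotSigma a₂ ⊗ₖ (1 : Matrix (Fin 2) (Fin 2) ℂ)) *
            ((1 : Matrix (Fin 2) (Fin 2) ℂ) ⊗ₖ dotSigma b₂))).trace =
          (ρ * ((dotSigma a₂ ⊗ₖ (1 : Matrix (Fin 2) (Fin 2) ℂ)) *
            ((1 : Matrix (Fin 2) (Fin 2) ℂ) ⊗ₖ dotSigma b₂))).trace) ∧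
        -- (3) Tr[ρ (A₃ ⊗ B₃)] preserved
        (T ρ * (dotSigma (unit3 (cross3 a₁ a₂)) ⊗ₖ dotSigma (unit3 (cross3 b₁ b₂)))).trace =
          (ρ * (dotSigma (unit3 (cross3 a₁ a₂)) ⊗ₖ dotSigma (unit3 (cross3 b₁ b₂)))).trace ∧
        -- (4) first moments vanish
        (T ρ * (dotSigma a₁ ⊗ₖ (1 : Matrix (Fin 2) (Fin 2) ℂ))).trace = 0 ∧
        (T ρ * (dotSigma a₂ ⊗ₖ (1 : Matrix (Fin 2) (Fin 2) ℂ))).trace = 0 ∧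
        (T ρ * ((1 : Matrix (Fin 2) (Fin 2) ℂ) ⊗ₖ dotSigma b₁)).trace = 0 ∧
        (T ρ * ((1 : Matrix (Fin 2) (Fin 2) ℂ) ⊗ₖ dotSigma b₂)).trace = 0 ∧
        -- (5) third moments vanish
        (T ρ * ((dotSigma a₁ ⊗ₖ (1 : Matrix (Fin 2) (Fin 2) ℂ)) *
            (dotSigma a₂ ⊗ₖ (1 : Matrix (Fin 2) (Fin 2) ℂ)) *
            ((1 : Matrix (Fin 2) (Fin 2) ℂ) ⊗ₖ dotSigma b₁))).trace = 0 ∧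
        (T ρ * ((dotSigma a₁ ⊗ₖ (1 : Matrix (Fin 2) (Fin 2) ℂ)) *
            (dotSigma a₂ ⊗ₖ (1 : Matrix (Fin 2) (Fin 2) ℂ)) *
            ((1 : Matrix (Fin 2) (Fin 2) ℂ) ⊗ₖ dotSigma b₂))).trace = 0 ∧
        (T ρ * ((dotSigma a₁ ⊗ₖ (1 : Matrix (Fin 2) (Fin 2) ℂ)) *
            ((1 : Matrix (Fin 2) (Fin 2) ℂ) ⊗ₖ dotSigma b₁) *
            ((1 : Matrix (Fin 2) (Fin 2) ℂ) ⊗ₖ dotSigma b₂))).trace = 0 ∧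
        (T ρ * ((dotSigma a₂ ⊗ₖ (1 : Matrix (Fin 2) (Fin 2) ℂ)) *
            ((1 : Matrix (Fin 2) (Fin 2) ℂ) ⊗ₖ dotSigma b₁) *
            ((1 : Matrix (Fin 2) (Fin 2) ℂ) ⊗ₖ dotSigma b₂))).trace = 0 ∧
        -- (6)
        (T ρ * (dotSigma (unit3 (cross3 a₁ a₂)) ⊗ₖ (1 : Matrix (Fin 2) (Fin 2) ℂ))).trace = 0 ∧
        (T ρ * ((1 : Matrix (Fin 2) (Fin 2) ℂ) ⊗ₖ dotSigma (unit3 (cross3 b₁ b₂)))).trace = 0) := by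
  have hA := unit3_unit _ hab
  have hB := unit3_unit _ hbb
  have sA1 := aux_sandwich _ _ hA (unit3_orth _ _ (cross3_orth1 a₁ a₂))
  have sA2 := aux_sandwich _ _ hA (unit3_orth _ _ (cross3_orth2 a₁ a₂))
  have sB1 := aux_sandwich _ _ hB (unit3_orth _ _ (cross3_orth1 b₁ b₂))
  have sB2 := aux_sandwich _ _ hB (unit3_orth _ _ (cross3_orth2 b₁ b₂))
  have qA := aux_sq _ hA
  have qB := aux_sq _ hB
  have eA := aux_herm (unit3 (cross3 a₁ a₂))
  have eB := aux_herm (unit3 (cross3 b₁ b₂))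
  have fA := aux_flip (unit3 (cross3 a₁ a₂))
  have fB := aux_flip (unit3 (cross3 b₁ b₂))
  generalize dotSigma (unit3 (cross3 a₁ a₂)) = A at *
  generalize dotSigma (unit3 (cross3 b₁ b₂)) = B at *
  have sAA := sandwich_mul A _ _ qA sA1 sA2
  have sBB := sandwich_mul B _ _ qB sB1 sB2
  refine ⟨Tmap (A ⊗ₖ B), fun ρ h => Tmap_density _ _ ?_ ?_ h, fun ρ _ => ?_⟩
  · rw [conjTranspose_kronecker, eA, eB]
  · rw [← mul_kronecker_mul, qA, qB, one_kronecker_one]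
  simp only [← mul_kronecker_mul, one_mul, mul_one]
  refine ⟨⟨?_, ?_, ?_, ?_⟩, ?_, ?_, ?_, ?_, ?_, ?_, ?_, ?_, ?_, ?_, ?_⟩
  · apply Tmap_trace_eq
    · rw [kron_conj, sA1, sB1, neg_kron_s8, kron_neg_s8, neg_neg]
    · rw [flip4_kron, aux_flip, aux_flip, neg_kron_s8, kron_neg_s8, neg_neg]
  · apply Tmap_trace_eq
    · rw [kron_conj, sA1, sB2, neg_kron_s8, kron_neg_s8, neg_neg]
    · rw [flip4_kron, aux_flip, aux_flip, neg_kron_s8, kron_neg_s8, neg_neg]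
  · apply Tmap_trace_eq
    · rw [kron_conj, sA2, sB1, neg_kron_s8, kron_neg_s8, neg_neg]
    · rw [flip4_kron, aux_flip, aux_flip, neg_kron_s8, kron_neg_s8, neg_neg]
  · apply Tmap_trace_eq
    · rw [kron_conj, sA2, sB2, neg_kron_s8, kron_neg_s8, neg_neg]
    · rw [flip4_kron, aux_flip, aux_flip, neg_kron_s8, kron_neg_s8, neg_neg]
  · apply Tmap_trace_eq
    · rw [kron_conj, qA, qB, one_mul, one_mul]
    · rw [flip4_kron, fA, fB, neg_kron_s8, kron_neg_s8, neg_neg]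
  · apply Tmap_trace_zero
    rw [kron_conj, sA1, mul_one, qB, neg_kron_s8]
  · apply Tmap_trace_zero
    rw [kron_conj, sA2, mul_one, qB, neg_kron_s8]
  · apply Tmap_trace_zero
    rw [kron_conj, sB1, mul_one, qA, kron_neg_s8]
  · apply Tmap_trace_zero
    rw [kron_conj, sB2, mul_one, qA, kron_neg_s8]
  · apply Tmap_trace_zero
    rw [kron_conj, sAA, sB1, kron_neg_s8]
  · apply Tmap_trace_zero
    rw [kron_conj, sAA, sB2, kron_neg_s8]
  · apply Tmap_trace_zero
    rw [kron_conj, sA1, sBB, neg_kron_s8]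
  · apply Tmap_trace_zero
    rw [kron_conj, sA2, sBB, neg_kron_s8]
  · apply Tmap_trace_zero'
    · rw [kron_conj, qA, mul_one, qB, one_mul]
    · rw [flip4_kron, fA, aux_flip_one, neg_kron_s8]
  · apply Tmap_trace_zero'
    · rw [kron_conj, qB, mul_one, qA, one_mul]
    · rw [flip4_kron, fB, aux_flip_one, kron_neg_s8]
end
end

section
/- Let C₁₁, C₂₁, C₁₂, C₂₂ be real numbers with |C_{ij}| ≤ 1 for all i, j ∈ {1,2}. Then the Tsirel'son–Landau inequality |C₁₁C₁₂ − C₂₁C₂₂| ≤ √(1−C₁₁²)·√(1−C₁₂²) + √(1−C₂₁²)·√(1−C₂₂²) holds if and only if for all k, l ∈ {1,2}, |arcsin C₁₁ + arcsin C₂₁ + arcsin C₁₂ + arcsin C₂₂ − 2·arcsin C_{kl}| ≤ π. -/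
open Real

theorem cos_add_cos_nonneg_aux {x y : ℝ} (hx : |x| ≤ π) (hy : |y| ≤ π) :
    0 ≤ Real.cos x + Real.cos y ↔ |x + y| ≤ π ∧ |x - y| ≤ π := by
  have h1 : Real.cos (π - |y|) = - Real.cos y := by
    rw [Real.cos_pi_sub, Real.cos_abs]
  have h2 := Real.strictAntiOn_cos.le_iff_ge (a := π - |y|) (b := |x|)
    ⟨by linarith, by linarith [abs_nonneg y]⟩ ⟨abs_nonneg x, hx⟩
  rw [h1, Real.cos_abs] at h2
  have h3 : |x + y| ≤ π ∧ |x - y| ≤ π ↔ |x| ≤ π - |y| := by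
    constructor
    · rintro ⟨h3, h4⟩
      rw [abs_le] at h3 h4
      rcases abs_cases x with h | h <;> rcases abs_cases y with h' | h' <;> linarith
    · intro h
      exact ⟨by linarith [abs_add_le x y], by linarith [abs_sub x y]⟩
  rw [h3, ← h2]
  constructor <;> intro h <;> linarith

/-- For `|Cᵢⱼ| ≤ 1`, the Tsirel'son–Landau inequality
`|C₁₁C₁₂ − C₂₁C₂₂| ≤ √(1−C₁₁²)√(1−C₁₂²) + √(1−C₂₁²)√(1−C₂₂²)` holds iff for all
`k, l`, `|arcsin C₁₁ + arcsin C₂₁ + arcsin C₁₂ + arcsin C₂₂ − 2 arcsin C_{kl}| ≤ π`.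
Here `C 0 0 = C₁₁`, `C 1 0 = C₂₁`, `C 0 1 = C₁₂`, `C 1 1 = C₂₂` (zero-based indices). -/
theorem stmt12 (C : Fin 2 → Fin 2 → ℝ) (h : ∀ i j, |C i j| ≤ 1) :
    (|C 0 0 * C 0 1 - C 1 0 * C 1 1| ≤
        Real.sqrt (1 - C 0 0 ^ 2) * Real.sqrt (1 - C 0 1 ^ 2) +
          Real.sqrt (1 - C 1 0 ^ 2) * Real.sqrt (1 - C 1 1 ^ 2)) ↔
      (∀ k l : Fin 2,
        |Real.arcsin (C 0 0) + Real.arcsin (C 1 0) + Real.arcsin (C 0 1) +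
            Real.arcsin (C 1 1) - 2 * Real.arcsin (C k l)| ≤ π) := by
  have hs : ∀ i j, Real.sin (Real.arcsin (C i j)) = C i j := fun i j =>
    Real.sin_arcsin (abs_le.mp (h i j)).1 (abs_le.mp (h i j)).2
  have hl : ∀ i j, -(π / 2) ≤ Real.arcsin (C i j) := fun i j => Real.neg_pi_div_two_le_arcsin _
  have hu : ∀ i j, Real.arcsin (C i j) ≤ π / 2 := fun i j => Real.arcsin_le_pi_div_two _
  simp only [← Real.cos_arcsin, Fin.forall_fin_two]
  have la := hl 0 0
  have lb := hl 0 1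
  have lc := hl 1 0
  have ld := hl 1 1
  have ua := hu 0 0
  have ub := hu 0 1
  have uc := hu 1 0
  have ud := hu 1 1
  have ea := hs 0 0
  have eb := hs 0 1
  have ec := hs 1 0
  have ed := hs 1 1
  generalize Real.arcsin (C 0 0) = a at *
  generalize Real.arcsin (C 0 1) = b at *
  generalize Real.arcsin (C 1 0) = c at *
  generalize Real.arcsin (C 1 1) = d at *
  rw [← ea, ← eb, ← ec, ← ed]
  have k1 := cos_add_cos_nonneg_aux (x := a + b) (y := c - d)
    (abs_le.mpr ⟨by linarith, by linarith⟩) (abs_le.mpr ⟨by linarith, by linarith⟩)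
  have k2 := cos_add_cos_nonneg_aux (x := a - b) (y := c + d)
    (abs_le.mpr ⟨by linarith, by linarith⟩) (abs_le.mpr ⟨by linarith, by linarith⟩)
  rw [Real.cos_add, Real.cos_sub] at k1 k2
  simp only [abs_le] at *
  constructor
  · rintro ⟨h1, h2⟩
    obtain ⟨⟨_, _⟩, _, _⟩ := k1.mp (by linarith)
    obtain ⟨⟨_, _⟩, _, _⟩ := k2.mp (by linarith)
    refine ⟨⟨⟨?_, ?_⟩, ?_, ?_⟩, ⟨?_, ?_⟩, ?_, ?_⟩ <;> linarith
  · rintro ⟨⟨⟨_, _⟩, _, _⟩, ⟨_, _⟩, _, _⟩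
    have h1 := k1.mpr ⟨⟨by linarith, by linarith⟩, by linarith, by linarith⟩
    have h2 := k2.mpr ⟨⟨by linarith, by linarith⟩, by linarith, by linarith⟩
    constructor <;> linarith
end

section
/- Let C₁₁, C₂₁, C₁₂, C₂₂ be real numbers with |C_{ij}| ≤ 1 for all i, j ∈ {1,2}. Then there exist complex numbers x and y such that the 4×4 complex matrix Γ := [[1, x, C₁₁, C₁₂], [conj(x), 1, C₂₁, C₂₂], [C₁₁, C₂₁, 1, y], [C₁₂, C₂₂, conj(y), 1]] is positive semidefinite if and only if |C₁₁C₁₂ − C₂₁C₂₂| ≤ √(1−C₁₁²)·√(1−C₁₂²) + √(1−C₂₁²)·√(1−C₂₂²). -/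
open Matrix ComplexOrder

lemma aux_nec (a b : ℝ) (y : ℂ) (ha : |a| ≤ 1) (hb : |b| ≤ 1)
    (h : (!![1, (a : ℂ), (b : ℂ); (a : ℂ), 1, y; (b : ℂ), starRingEnd ℂ y, 1] :
      Matrix (Fin 3) (Fin 3) ℂ).PosSemidef) :
    |y.re - a * b| ≤ Real.sqrt (1 - a ^ 2) * Real.sqrt (1 - b ^ 2) := by
  have h1 := h.det_nonneg
  rw [Matrix.det_fin_three] at h1
  have h2 := (Complex.le_def.1 h1).1
  simp [Complex.mul_re] at h2
  have ha2 : a ^ 2 ≤ 1 := (sq_le_one_iff_abs_le_one a).2 ha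
  rw [← Real.sqrt_mul (by linarith)]
  apply Real.abs_le_sqrt
  nlinarith [sq_nonneg y.im]

lemma aux_le_one (a b : ℝ) (ha : |a| ≤ 1) (hb : |b| ≤ 1) :
    |a * b| + Real.sqrt (1 - a ^ 2) * Real.sqrt (1 - b ^ 2) ≤ 1 := by
  have ha2 : a ^ 2 ≤ 1 := (sq_le_one_iff_abs_le_one a).2 ha
  have hb2 : b ^ 2 ≤ 1 := (sq_le_one_iff_abs_le_one b).2 hb
  have e1 := Real.sq_sqrt (show 0 ≤ 1 - a ^ 2 by linarith)
  have e2 := Real.sq_sqrt (show 0 ≤ 1 - b ^ 2 by linarith)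
  rw [abs_mul]
  nlinarith [sq_nonneg (|a| - |b|), sq_abs a, sq_abs b,
    sq_nonneg (Real.sqrt (1 - a ^ 2) - Real.sqrt (1 - b ^ 2))]

lemma aux_suf (a b y t : ℝ) (ha : |a| ≤ 1) (hb : |b| ≤ 1) (ht : t ^ 2 = 1 - y ^ 2)
    (h : |y - a * b| ≤ Real.sqrt (1 - a ^ 2) * Real.sqrt (1 - b ^ 2)) :
    ∃ p r : ℝ, a * a + p * p + r * r = 1 ∧ a * y + p * t = b := by
  have ha2 : a ^ 2 ≤ 1 := (sq_le_one_iff_abs_le_one a).2 ha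
  have hb2 : b ^ 2 ≤ 1 := (sq_le_one_iff_abs_le_one b).2 hb
  have h' : (y - a * b) ^ 2 ≤ (1 - a ^ 2) * (1 - b ^ 2) := by
    rw [← Real.sqrt_mul (by linarith)] at h
    rw [← sq_abs]
    have hnn : 0 ≤ (1 - a ^ 2) * (1 - b ^ 2) := mul_nonneg (by linarith) (by linarith)
    exact (Real.le_sqrt (abs_nonneg _) hnn).1 h
  have hd : (b - a * y) ^ 2 ≤ (1 - a ^ 2) * t ^ 2 := by rw [ht]; nlinarith
  by_cases h0 : t = 0
  · refine ⟨0, Real.sqrt (1 - a ^ 2), ?_, ?_⟩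
    · rw [Real.mul_self_sqrt (by linarith)]; ring
    · have : b - a * y = 0 := by
        rw [h0] at hd
        exact pow_eq_zero_iff (two_ne_zero) |>.1 (le_antisymm (by linarith) (sq_nonneg _))
      linarith
  · have hp : ((b - a * y) / t) ^ 2 ≤ 1 - a ^ 2 := by
      rw [div_pow, div_le_iff₀ (by positivity)]; exact hd
    refine ⟨(b - a * y) / t, Real.sqrt (1 - a ^ 2 - ((b - a * y) / t) ^ 2), ?_, ?_⟩
    · rw [Real.mul_self_sqrt (by linarith)]; ring
    · field_simp; ring

/-- For `|Cᵢⱼ| ≤ 1`, there exist `x, y ∈ ℂ` making the matrix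
`Γ = [[1, x, C₁₁, C₁₂], [x*, 1, C₂₁, C₂₂], [C₁₁, C₂₁, 1, y], [C₁₂, C₂₂, y*, 1]]`
positive semidefinite iff the Tsirel'son–Landau inequality holds. -/
theorem stmt13 (C11 C21 C12 C22 : ℝ)
    (h11 : |C11| ≤ 1) (h21 : |C21| ≤ 1) (h12 : |C12| ≤ 1) (h22 : |C22| ≤ 1) :
    (∃ x y : ℂ,
        (!![1, x, (C11 : ℂ), (C12 : ℂ);
            starRingEnd ℂ x, 1, (C21 : ℂ), (C22 : ℂ);
            (C11 : ℂ), (C21 : ℂ), 1, y;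
            (C12 : ℂ), (C22 : ℂ), starRingEnd ℂ y, 1] :
          Matrix (Fin 4) (Fin 4) ℂ).PosSemidef) ↔
      |C11 * C12 - C21 * C22| ≤
        Real.sqrt (1 - C11 ^ 2) * Real.sqrt (1 - C12 ^ 2) +
          Real.sqrt (1 - C21 ^ 2) * Real.sqrt (1 - C22 ^ 2) := by
  constructor
  · rintro ⟨x, y, h⟩
    have k1 := aux_nec C11 C12 y h11 h12 (by
      convert h.submatrix ![0, 2, 3] using 1
      ext i j; fin_cases i <;> fin_cases j <;> simp)
    have k2 := aux_nec C21 C22 y h21 h22 (by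
      convert h.submatrix ![1, 2, 3] using 1
      ext i j; fin_cases i <;> fin_cases j <;> simp)
    rw [abs_le] at *
    constructor <;> linarith
  · intro h
    obtain ⟨y, k1, k2⟩ : ∃ y : ℝ,
        |y - C11 * C12| ≤ Real.sqrt (1 - C11 ^ 2) * Real.sqrt (1 - C12 ^ 2) ∧
        |y - C21 * C22| ≤ Real.sqrt (1 - C21 ^ 2) * Real.sqrt (1 - C22 ^ 2) := by
      have n1 : 0 ≤ Real.sqrt (1 - C11 ^ 2) * Real.sqrt (1 - C12 ^ 2) := by positivity
      have n2 : 0 ≤ Real.sqrt (1 - C21 ^ 2) * Real.sqrt (1 - C22 ^ 2) := by positivity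
      refine ⟨max (C11 * C12 - Real.sqrt (1 - C11 ^ 2) * Real.sqrt (1 - C12 ^ 2))
        (C21 * C22 - Real.sqrt (1 - C21 ^ 2) * Real.sqrt (1 - C22 ^ 2)), ?_⟩
      rw [abs_le] at h
      rw [abs_le, abs_le]
      obtain ⟨ha, hb⟩ := h
      refine ⟨⟨?_, ?_⟩, ?_, ?_⟩ <;>
      rcases max_cases (C11 * C12 - Real.sqrt (1 - C11 ^ 2) * Real.sqrt (1 - C12 ^ 2))
        (C21 * C22 - Real.sqrt (1 - C21 ^ 2) * Real.sqrt (1 - C22 ^ 2)) with ⟨e, e'⟩ | ⟨e, e'⟩ <;>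
      rw [e] <;> linarith
    have hy : |y| ≤ 1 := by
      have := aux_le_one C11 C12 h11 h12
      have := abs_add_le (y - C11 * C12) (C11 * C12)
      rw [sub_add_cancel] at this
      linarith
    have hy2 : y ^ 2 ≤ 1 := (sq_le_one_iff_abs_le_one y).2 hy
    obtain ⟨t, ht⟩ : ∃ t : ℝ, t ^ 2 = 1 - y ^ 2 := ⟨_, Real.sq_sqrt (by linarith)⟩
    obtain ⟨p, r, e1, e2⟩ := aux_suf C11 C12 y t h11 h12 ht k1
    obtain ⟨q, s, e3, e4⟩ := aux_suf C21 C22 y t h21 h22 ht k2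
    have e5 : y * y + t * t = 1 := by linarith
    refine ⟨((C11 * C21 + p * q + r * s : ℝ) : ℂ), (y : ℂ), ?_⟩
    have key := Matrix.posSemidef_conjTranspose_mul_self
      ((!![C11, C21, 1, y; p, q, 0, t; r, s, 0, 0] : Matrix (Fin 3) (Fin 4) ℝ).map
        (fun z : ℝ => (z : ℂ)))
    convert key using 1
    have f1 := congrArg (fun z : ℝ => (z : ℂ)) e1
    have f2 := congrArg (fun z : ℝ => (z : ℂ)) e2
    have f3 := congrArg (fun z : ℝ => (z : ℂ)) e3
    have f4 := congrArg (fun z : ℝ => (z : ℂ)) e4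
    have f5 := congrArg (fun z : ℝ => (z : ℂ)) e5
    push_cast at f1 f2 f3 f4 f5
    ext i j
    fin_cases i <;> fin_cases j <;>
      simp [Matrix.mul_apply, Fin.sum_univ_three] <;>
      first
        | ring1
        | linear_combination -f1
        | linear_combination -f2
        | linear_combination -f3
        | linear_combination -f4
        | linear_combination -f5
end

section
/- For all real numbers C₁₁, C₁₂, C₂₂: if √((C₁₁ + C₂₂)² + (C₁₂ + 1)²) + √((C₁₁ − C₂₂)² + (C₁₂ − 1)²) ≤ 2 (the quantum realizability condition for anti-commuting observables, α = β = π/2, applied to the correlation vector (C₁₁, −1, C₁₂, C₂₂)), then Bell's original inequality |C₁₁ − C₁₂| ≤ 1 + C₂₂ holds. -/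
/-- If the quantum realizability condition
`√((C₁₁+C₂₂)² + (C₁₂+1)²) + √((C₁₁−C₂₂)² + (C₁₂−1)²) ≤ 2` (for the correlation
vector `(C₁₁, −1, C₁₂, C₂₂)` with anti-commuting observables) holds, then Bell's
original inequality `|C₁₁ − C₁₂| ≤ 1 + C₂₂` holds. -/
theorem stmt15 (C11 C12 C22 : ℝ)
    (h : Real.sqrt ((C11 + C22) ^ 2 + (C12 + 1) ^ 2) +
        Real.sqrt ((C11 - C22) ^ 2 + (C12 - 1) ^ 2) ≤ 2) :
    |C11 - C12| ≤ 1 + C22 := by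
  have ha := Real.abs_le_sqrt (show (C12 + 1) ^ 2 ≤ (C11 + C22) ^ 2 + (C12 + 1) ^ 2 by
    nlinarith [sq_nonneg (C11 + C22)])
  have hb := Real.abs_le_sqrt (show (C12 - 1) ^ 2 ≤ (C11 - C22) ^ 2 + (C12 - 1) ^ 2 by
    nlinarith [sq_nonneg (C11 - C22)])
  have ea := Real.sq_sqrt (show 0 ≤ (C11 + C22) ^ 2 + (C12 + 1) ^ 2 by positivity)
  have eb := Real.sq_sqrt (show 0 ≤ (C11 - C22) ^ 2 + (C12 - 1) ^ 2 by positivity)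
  generalize Real.sqrt ((C11 + C22) ^ 2 + (C12 + 1) ^ 2) = a at *
  generalize Real.sqrt ((C11 - C22) ^ 2 + (C12 - 1) ^ 2) = b at *
  obtain ⟨a1, a2⟩ := abs_le.mp ha
  obtain ⟨b1, b2⟩ := abs_le.mp hb
  have h1 : a = C12 + 1 := by linarith
  have h2 : b = 1 - C12 := by linarith
  subst h1 h2
  have p : C11 + C22 = 0 := by
    apply pow_eq_zero_iff (two_ne_zero) |>.mp
    linarith
  have q : C11 - C22 = 0 := by
    apply pow_eq_zero_iff (two_ne_zero) |>.mp
    nlinarith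
  rw [abs_le]
  constructor <;> linarith
end

section
/- Set α = β = π/4 and let F_{α,β} and F_{α,−β} be the corresponding 4×4 real matrices. Then for every real number c with −1 ≤ c ≤ 0, the vector γ := (−√2/2, −1, c, −√2/2)ᵀ satisfies √(γᵀ F_{π/4, π/4} γ) + √(γᵀ F_{π/4, −π/4} γ) = 2; that is, the quantum realizability condition holds with equality, while Bell's original inequality |γ₁ − γ₃| ≤ 1 + γ₄ is violated whenever 1 − √2 < c. -/
open Matrix Kronecker Real ComplexOrder

noncomputable section

/-- For `α = β = π/4` and `−1 ≤ c ≤ 0`, the vector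
`γ = (−√2/2, −1, c, −√2/2)` saturates the quantum realizability condition
(`√(γᵀ F γ) + √(γᵀ F' γ) = 2`), while Bell's original inequality
`|γ₁ − γ₃| ≤ 1 + γ₄` is violated whenever `1 − √2 < c`. -/
theorem stmt16 (c : ℝ) (hc₁ : -1 ≤ c) (hc₂ : c ≤ 0) :
    Real.sqrt (quadForm (π / 4) (π / 4) ![-(Real.sqrt 2 / 2), -1, c, -(Real.sqrt 2 / 2)]) +
        Real.sqrt (quadForm (π / 4) (-(π / 4)) ![-(Real.sqrt 2 / 2), -1, c, -(Real.sqrt 2 / 2)])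
      = 2 ∧
    (1 - Real.sqrt 2 < c →
      ¬ |(-(Real.sqrt 2 / 2)) - c| ≤ 1 + (-(Real.sqrt 2 / 2))) := by
  have h2 : Real.sqrt 2 * Real.sqrt 2 = 2 := Real.mul_self_sqrt (by norm_num)
  have hs : (Real.sqrt 2 / 2) ^ 2 = 1 / 2 := by nlinarith
  have e1 : π / 4 + π / 4 = π / 2 := by ring
  have key1 : quadForm (π / 4) (π / 4) ![-(Real.sqrt 2 / 2), -1, c, -(Real.sqrt 2 / 2)]
      = (2 * -c) ^ 2 := by
    simp only [quadForm, Fmat, sub_self, e1, Real.cos_pi_div_two, Real.cos_zero,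
      Real.cos_pi_div_four, Real.sin_pi_div_four, hs]
    simp [Matrix.mulVec, dotProduct, Fin.sum_univ_four]
    generalize Real.sqrt 2 = s at *
    grind
  have key2 : quadForm (π / 4) (-(π / 4)) ![-(Real.sqrt 2 / 2), -1, c, -(Real.sqrt 2 / 2)]
      = (2 * (1 + c)) ^ 2 := by
    simp only [quadForm, Fmat, sub_neg_eq_add, add_neg_cancel, e1, Real.cos_pi_div_two,
      Real.cos_zero, Real.cos_neg, Real.sin_neg, neg_sq,
      Real.cos_pi_div_four, Real.sin_pi_div_four, hs]
    simp [Matrix.mulVec, dotProduct, Fin.sum_univ_four]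
    generalize Real.sqrt 2 = s at *
    grind
  refine ⟨?_, ?_⟩
  · rw [key1, key2, Real.sqrt_sq (by linarith), Real.sqrt_sq (by linarith)]
    ring
  · intro h hb
    have := (abs_le.mp hb).1
    linarith
end
end

section
/- Let α, β ∈ (0, π) and let γ = (γ₁₁, γ₂₁, γ₁₂, γ₂₂)ᵀ ∈ ℝ⁴ satisfy γ₁₁ = γ₁₂ and γ₂₁ = γ₂₂. Then √(γᵀ F_{α,β} γ) + √(γᵀ F_{α,−β} γ) ≤ 2 holds if and only if √((2/(1 + cos β))·(γ₁₁² + γ₂₁² − 2 γ₁₁ γ₂₁ cos α)) ≤ sin α. -/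
open Matrix Kronecker Real ComplexOrder

noncomputable section

/-- For `α, β ∈ (0,π)` and `γ` with `γ₁₁ = γ₁₂`, `γ₂₁ = γ₂₂`,
the condition `√(γᵀ F_{α,β} γ) + √(γᵀ F_{α,−β} γ) ≤ 2` is equivalent to
`√((2/(1+cos β))(γ₁₁² + γ₂₁² − 2 γ₁₁ γ₂₁ cos α)) ≤ sin α`. -/
theorem stmt18 (α β : ℝ) (hα : α ∈ Set.Ioo 0 π) (hβ : β ∈ Set.Ioo 0 π)
    (γ11 γ21 γ12 γ22 : ℝ) (h1 : γ11 = γ12) (h2 : γ21 = γ22) :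
    (Real.sqrt (quadForm α β ![γ11, γ21, γ12, γ22]) +
        Real.sqrt (quadForm α (-β) ![γ11, γ21, γ12, γ22]) ≤ 2) ↔
      Real.sqrt (2 / (1 + Real.cos β) *
          (γ11 ^ 2 + γ21 ^ 2 - 2 * γ11 * γ21 * Real.cos α)) ≤ Real.sin α := by
  subst h1 h2
  have sa : 0 < Real.sin α := Real.sin_pos_of_mem_Ioo hα
  have sb : 0 < Real.sin β := Real.sin_pos_of_mem_Ioo hβ
  have hb := Real.sin_sq_add_cos_sq β
  have hc : 1 + Real.cos β ≠ 0 := by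
    intro h
    have : Real.cos β = -1 := by linarith
    rw [this] at hb
    nlinarith
  have hc' : 1 - Real.cos β ≠ 0 := by
    intro h
    have : Real.cos β = 1 := by linarith
    rw [this] at hb
    nlinarith
  have hs : Real.sin β ^ 2 = (1 - Real.cos β) * (1 + Real.cos β) := by linarith
  have key : ∀ a b : ℝ, quadForm α β ![a, b, a, b] =
      (2 / (1 + Real.cos β) * (a ^ 2 + b ^ 2 - 2 * a * b * Real.cos α)) / Real.sin α ^ 2 := by
    intro a b
    simp only [quadForm, Fmat, Matrix.smul_mulVec, dotProduct_smul, Real.cos_add, Real.cos_sub, hs]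
    simp [Matrix.mulVec, dotProduct, Fin.sum_univ_succ]
    field_simp
    ring
  have key2 : ∀ a b : ℝ, quadForm α (-β) ![a, b, a, b] = quadForm α β ![a, b, a, b] := by
    intro a b
    simp only [quadForm, Fmat, Matrix.smul_mulVec, dotProduct_smul, Real.cos_add, Real.cos_sub,
      Real.sin_neg, Real.cos_neg, neg_sq]
    simp [Matrix.mulVec, dotProduct, Fin.sum_univ_succ]
    left
    ring
  rw [key2, key, Real.sqrt_div' _ (sq_nonneg _), Real.sqrt_sq sa.le, ← two_mul]
  rw [← div_le_one sa]
  constructor <;> intro h <;> linarith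
end
end

section
/- Let C₁₀, C₂₀, C₀₁, C₀₂ and C₁₁, C₁₂, C₂₁, C₂₂ be real numbers satisfying |C_{i0}| ≤ 1, |C_{0j}| ≤ 1, and |C_{i0} + C_{0j}| − 1 ≤ C_{ij} ≤ 1 − |C_{i0} − C_{0j}| for all i, j ∈ {1,2}. Then there exists a probability distribution P on {−1, +1}⁴ (a function P : {−1,+1}⁴ → ℝ with P ≥ 0 and total sum 1, the four coordinates being interpreted as the values a₁, a₂, b₁, b₂ of A₁, A₂, B₁, B₂) such that Σ a_i·P(a₁,a₂,b₁,b₂) = C_{i0}, Σ b_j·P(a₁,a₂,b₁,b₂) = C_{0j}, and Σ a_i·b_j·P(a₁,a₂,b₁,b₂) = C_{ij} for all i, j ∈ {1,2} (sums over all (a₁,a₂,b₁,b₂) ∈ {−1,+1}⁴), if and only if the CHSH inequalities hold: for all k, l ∈ {1,2}, |C₁₁ + C₁₂ + C₂₁ + C₂₂ − 2·C_{kl}| ≤ 2. -/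
open Finset

/-- A one-parameter choice: a common point of finitely many intervals (three lower, three upper). -/
lemma exists_between_three (l1 l2 l3 u1 u2 u3 : ℝ)
    (h11 : l1 ≤ u1) (h12 : l1 ≤ u2) (h13 : l1 ≤ u3)
    (h21 : l2 ≤ u1) (h22 : l2 ≤ u2) (h23 : l2 ≤ u3)
    (h31 : l3 ≤ u1) (h32 : l3 ≤ u2) (h33 : l3 ≤ u3) :
    ∃ s : ℝ, l1 ≤ s ∧ l2 ≤ s ∧ l3 ≤ s ∧ s ≤ u1 ∧ s ≤ u2 ∧ s ≤ u3 := by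
  refine ⟨max l1 (max l2 l3), ?_⟩
  simp_all

/-- The same with four lower and four upper bounds. -/
lemma exists_between_four (l1 l2 l3 l4 u1 u2 u3 u4 : ℝ)
    (h1 : l1 ≤ u1 ∧ l1 ≤ u2 ∧ l1 ≤ u3 ∧ l1 ≤ u4)
    (h2 : l2 ≤ u1 ∧ l2 ≤ u2 ∧ l2 ≤ u3 ∧ l2 ≤ u4)
    (h3 : l3 ≤ u1 ∧ l3 ≤ u2 ∧ l3 ≤ u3 ∧ l3 ≤ u4)
    (h4 : l4 ≤ u1 ∧ l4 ≤ u2 ∧ l4 ≤ u3 ∧ l4 ≤ u4) :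
    ∃ s : ℝ, l1 ≤ s ∧ l2 ≤ s ∧ l3 ≤ s ∧ l4 ≤ s ∧ s ≤ u1 ∧ s ≤ u2 ∧ s ≤ u3 ∧ s ≤ u4 := by
  refine ⟨max (max l1 l2) (max l3 l4), ?_⟩
  simp_all

/-- Three `±1` variables with compatible pair correlations: a triple correlation `t` exists. -/
lemma triple_exists (A B D X Y s : ℝ)
    (hXl : |A + B| - 1 ≤ X) (hXu : X ≤ 1 - |A - B|)
    (hYl : |A + D| - 1 ≤ Y) (hYu : Y ≤ 1 - |A - D|)
    (hsl : |B + D| - 1 ≤ s) (hsu : s ≤ 1 - |B - D|)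
    (htl : |X + Y| - 1 ≤ s) (htu : s ≤ 1 - |X - Y|) :
    ∃ t : ℝ, 0 ≤ 1 + A + B + D + X + Y + s + t ∧ 0 ≤ 1 + A + B - D + X - Y - s - t ∧
      0 ≤ 1 + A - B + D - X + Y - s - t ∧ 0 ≤ 1 + A - B - D - X - Y + s + t ∧
      0 ≤ 1 - A + B + D - X - Y + s - t ∧ 0 ≤ 1 - A + B - D - X + Y - s + t ∧
      0 ≤ 1 - A - B + D + X - Y - s + t ∧ 0 ≤ 1 - A - B - D + X + Y + s - t := by
  have e : ∀ {x y : ℝ}, |x| - 1 ≤ y → x - 1 ≤ y ∧ -x - 1 ≤ y := fun {x y} h =>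
    ⟨by linarith [le_abs_self x], by linarith [neg_le_abs x]⟩
  have f : ∀ {x y : ℝ}, y ≤ 1 - |x| → y ≤ 1 - x ∧ y ≤ 1 + x := fun {x y} h =>
    ⟨by linarith [le_abs_self x], by linarith [neg_le_abs x]⟩
  obtain ⟨a1, a2⟩ := e hXl
  obtain ⟨a3, a4⟩ := e hYl
  obtain ⟨a5, a6⟩ := e hsl
  obtain ⟨a7, a8⟩ := e htl
  obtain ⟨b1, b2⟩ := f hXu
  obtain ⟨b3, b4⟩ := f hYu
  obtain ⟨b5, b6⟩ := f hsu
  obtain ⟨b7, b8⟩ := f htu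
  obtain ⟨t, c1, c2, c3, c4, c5, c6, c7, c8⟩ := exists_between_four
    (-(1 + A + B + D + X + Y + s)) (-(1 + A - B - D - X - Y + s))
    (-(1 - A + B - D - X + Y - s)) (-(1 - A - B + D + X - Y - s))
    (1 + A + B - D + X - Y - s) (1 + A - B + D - X + Y - s)
    (1 - A + B + D - X - Y + s) (1 - A - B - D + X + Y + s)
    (by refine ⟨?_, ?_, ?_, ?_⟩ <;> linarith) (by refine ⟨?_, ?_, ?_, ?_⟩ <;> linarith)
    (by refine ⟨?_, ?_, ?_, ?_⟩ <;> linarith) (by refine ⟨?_, ?_, ?_, ?_⟩ <;> linarith)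
  exact ⟨t, by linarith, by linarith, by linarith, by linarith, by linarith, by linarith,
    by linarith, by linarith⟩

/-- A nonnegative 2×2 table with prescribed marginals. -/
lemma glue (x y u v : ℝ) (hx : 0 ≤ x) (hy : 0 ≤ y) (hu : 0 ≤ u) (hv : 0 ≤ v)
    (h : x + y = u + v) :
    ∃ p q r w : ℝ, 0 ≤ p ∧ 0 ≤ q ∧ 0 ≤ r ∧ 0 ≤ w ∧
      p + q = x ∧ r + w = y ∧ p + r = u ∧ q + w = v := by
  rcases le_total x u with hxu | hxu
  · exact ⟨x, 0, u - x, v, hx, le_rfl, by linarith, hv, by ring, by linarith, by ring, by ring⟩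
  · exact ⟨u, x - u, 0, y, hu, by linarith, le_rfl, hy, by ring, by ring, by ring, by linarith⟩

set_option maxHeartbeats 4000000 in
/-- (Fine's theorem, correlation form) Given expectation values
`Cᵢ₀, C₀ⱼ` and correlations `Cᵢⱼ` satisfying the compatibility bounds, a joint
probability distribution `P` on `{−1,+1}⁴` reproducing them exists iff the CHSH
inequalities `|C₁₁ + C₁₂ + C₂₁ + C₂₂ − 2 C_{kl}| ≤ 2` hold for all `k, l ∈ {1,2}`. -/
theorem stmt19 (C10 C20 C01 C02 C11 C21 C12 C22 : ℝ)
    (h10 : |C10| ≤ 1) (h20 : |C20| ≤ 1) (h01 : |C01| ≤ 1) (h02 : |C02| ≤ 1)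
    (h11l : |C10 + C01| - 1 ≤ C11) (h11u : C11 ≤ 1 - |C10 - C01|)
    (h12l : |C10 + C02| - 1 ≤ C12) (h12u : C12 ≤ 1 - |C10 - C02|)
    (h21l : |C20 + C01| - 1 ≤ C21) (h21u : C21 ≤ 1 - |C20 - C01|)
    (h22l : |C20 + C02| - 1 ≤ C22) (h22u : C22 ≤ 1 - |C20 - C02|) :
    (∃ P : ℝ → ℝ → ℝ → ℝ → ℝ,
        (∀ a₁ ∈ ({-1, 1} : Finset ℝ), ∀ a₂ ∈ ({-1, 1} : Finset ℝ),
          ∀ b₁ ∈ ({-1, 1} : Finset ℝ), ∀ b₂ ∈ ({-1, 1} : Finset ℝ),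
            0 ≤ P a₁ a₂ b₁ b₂) ∧
        (∑ a₁ ∈ ({-1, 1} : Finset ℝ), ∑ a₂ ∈ ({-1, 1} : Finset ℝ),
          ∑ b₁ ∈ ({-1, 1} : Finset ℝ), ∑ b₂ ∈ ({-1, 1} : Finset ℝ),
            P a₁ a₂ b₁ b₂) = 1 ∧
        (∑ a₁ ∈ ({-1, 1} : Finset ℝ), ∑ a₂ ∈ ({-1, 1} : Finset ℝ),
          ∑ b₁ ∈ ({-1, 1} : Finset ℝ), ∑ b₂ ∈ ({-1, 1} : Finset ℝ),
            a₁ * P a₁ a₂ b₁ b₂) = C10 ∧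
        (∑ a₁ ∈ ({-1, 1} : Finset ℝ), ∑ a₂ ∈ ({-1, 1} : Finset ℝ),
          ∑ b₁ ∈ ({-1, 1} : Finset ℝ), ∑ b₂ ∈ ({-1, 1} : Finset ℝ),
            a₂ * P a₁ a₂ b₁ b₂) = C20 ∧
        (∑ a₁ ∈ ({-1, 1} : Finset ℝ), ∑ a₂ ∈ ({-1, 1} : Finset ℝ),
          ∑ b₁ ∈ ({-1, 1} : Finset ℝ), ∑ b₂ ∈ ({-1, 1} : Finset ℝ),
            b₁ * P a₁ a₂ b₁ b₂) = C01 ∧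
        (∑ a₁ ∈ ({-1, 1} : Finset ℝ), ∑ a₂ ∈ ({-1, 1} : Finset ℝ),
          ∑ b₁ ∈ ({-1, 1} : Finset ℝ), ∑ b₂ ∈ ({-1, 1} : Finset ℝ),
            b₂ * P a₁ a₂ b₁ b₂) = C02 ∧
        (∑ a₁ ∈ ({-1, 1} : Finset ℝ), ∑ a₂ ∈ ({-1, 1} : Finset ℝ),
          ∑ b₁ ∈ ({-1, 1} : Finset ℝ), ∑ b₂ ∈ ({-1, 1} : Finset ℝ),
            a₁ * b₁ * P a₁ a₂ b₁ b₂) = C11 ∧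
        (∑ a₁ ∈ ({-1, 1} : Finset ℝ), ∑ a₂ ∈ ({-1, 1} : Finset ℝ),
          ∑ b₁ ∈ ({-1, 1} : Finset ℝ), ∑ b₂ ∈ ({-1, 1} : Finset ℝ),
            a₁ * b₂ * P a₁ a₂ b₁ b₂) = C12 ∧
        (∑ a₁ ∈ ({-1, 1} : Finset ℝ), ∑ a₂ ∈ ({-1, 1} : Finset ℝ),
          ∑ b₁ ∈ ({-1, 1} : Finset ℝ), ∑ b₂ ∈ ({-1, 1} : Finset ℝ),
            a₂ * b₁ * P a₁ a₂ b₁ b₂) = C21 ∧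
        (∑ a₁ ∈ ({-1, 1} : Finset ℝ), ∑ a₂ ∈ ({-1, 1} : Finset ℝ),
          ∑ b₁ ∈ ({-1, 1} : Finset ℝ), ∑ b₂ ∈ ({-1, 1} : Finset ℝ),
            a₂ * b₂ * P a₁ a₂ b₁ b₂) = C22) ↔
      (|C11 + C12 + C21 + C22 - 2 * C11| ≤ 2 ∧
        |C11 + C12 + C21 + C22 - 2 * C21| ≤ 2 ∧
        |C11 + C12 + C21 + C22 - 2 * C12| ≤ 2 ∧
        |C11 + C12 + C21 + C22 - 2 * C22| ≤ 2) := by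
  have ne : (-1 : ℝ) ≠ 1 := by norm_num
  have S : ∀ f : ℝ → ℝ, ∑ a ∈ ({-1, 1} : Finset ℝ), f a = f (-1) + f 1 :=
    fun f => Finset.sum_pair ne
  simp only [S, Finset.mem_insert, Finset.mem_singleton, forall_eq_or_imp, forall_eq]
  constructor
  · rintro ⟨P, ⟨⟨⟨⟨n1, n2⟩, n3, n4⟩, ⟨n5, n6⟩, n7, n8⟩, ⟨⟨n9, n10⟩, n11, n12⟩,
      ⟨n13, n14⟩, n15, n16⟩, e0, -, -, -, -, e1, e2, e3, e4⟩
    refine ⟨?_, ?_, ?_, ?_⟩ <;> rw [abs_le] <;> constructor <;> linarith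
  · rintro ⟨k1, k2, k3, k4⟩
    obtain ⟨s, s1, s2, s3, s4, s5, s6⟩ := exists_between_three
      (|C01 + C02| - 1) (|C11 + C12| - 1) (|C21 + C22| - 1)
      (1 - |C01 - C02|) (1 - |C11 - C12|) (1 - |C21 - C22|)
      (by grind) (by grind) (by grind) (by grind) (by grind) (by grind)
      (by grind) (by grind) (by grind)
    obtain ⟨t, t1, t2, t3, t4, t5, t6, t7, t8⟩ :=
      triple_exists C10 C01 C02 C11 C12 s h11l h11u h12l h12u s1 s4 s2 s5
    obtain ⟨r, r1, r2, r3, r4, r5, r6, r7, r8⟩ :=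
      triple_exists C20 C01 C02 C21 C22 s h21l h21u h22l h22u s1 s4 s3 s6
    obtain ⟨p1, p2, p3, p4, p5, p6, p7, p8, p9, p10, p11, p12⟩ :=
      glue _ _ _ _ t1 t5 r1 r5 (by ring)
    obtain ⟨q1, q2, q3, q4, q5, q6, q7, q8, q9, q10, q11, q12⟩ :=
      glue _ _ _ _ t2 t6 r2 r6 (by ring)
    obtain ⟨v1, v2, v3, v4, v5, v6, v7, v8, v9, v10, v11, v12⟩ :=
      glue _ _ _ _ t3 t7 r3 r7 (by ring)
    obtain ⟨w1, w2, w3, w4, w5, w6, w7, w8, w9, w10, w11, w12⟩ :=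
      glue _ _ _ _ t4 t8 r4 r8 (by ring)
    let T : ℝ → ℝ → ℝ → ℝ → ℝ → ℝ → ℝ := fun x y z w a b =>
      if a = 1 then (if b = 1 then x else y) else (if b = 1 then z else w)
    refine ⟨fun a₁ a₂ b₁ b₂ => T (T p1 p2 p3 p4 a₁ a₂) (T q1 q2 q3 q4 a₁ a₂)
      (T v1 v2 v3 v4 a₁ a₂) (T w1 w2 w3 w4 a₁ a₂) b₁ b₂ / 8, ?_⟩
    simp only [T, if_true, if_neg ne]
    clear h10 h20 h01 h02 h11l h11u h12l h12u h21l h21u h22l h22u k1 k2 k3 k4 s1 s2 s3 s4 s5 s6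
    clear t1 t2 t3 t4 t5 t6 t7 t8 r1 r2 r3 r4 r5 r6 r7 r8
    refine ⟨⟨⟨⟨⟨?_, ?_⟩, ?_, ?_⟩, ⟨?_, ?_⟩, ?_, ?_⟩, ⟨⟨?_, ?_⟩, ?_, ?_⟩,
      ⟨?_, ?_⟩, ?_, ?_⟩, ?_, ?_, ?_, ?_, ?_, ?_, ?_, ?_, ?_⟩ <;> linarith
end
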